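/- arXiv:1312.2529 — 2 statements merged into one kernel-verified Lean document; each statement's English description precedes it below -/
import Mathlib

section
/- There exists a universal constant C > 0 such that for every n, every isotropic log-concave random vector X in ℝⁿ, every nonempty subset I ⊆ {1,…,n}, and every t ≥ C·|I|, one has P(∑_{i∈I} X_i² ≥ t) ≤ exp(−σ_X^{−1}(√t / C)). -/
open MeasureTheory ProbabilityTheory Real
open scoped Pointwise ENNReal RealInnerProductSpace

noncomputable section

variable {Ω : Type*} [MeasurableSpace Ω]

/-- A random vector `X` in `ℝⁿ` is log-concave: for all nonempty compact sets `K, L` and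
`a ∈ [0,1]`, `P(X ∈ aK + (1-a)L) ≥ P(X ∈ K)^a * P(X ∈ L)^(1-a)`. -/
def IsLogConcave {n : ℕ} (μ : Measure Ω) (X : Ω → EuclideanSpace ℝ (Fin n)) : Prop :=
  ∀ K L : Set (EuclideanSpace ℝ (Fin n)), K.Nonempty → L.Nonempty →
    IsCompact K → IsCompact L → ∀ a : ℝ, 0 ≤ a → a ≤ 1 →
      (μ (X ⁻¹' K)).toReal ^ a * (μ (X ⁻¹' L)).toReal ^ (1 - a) ≤
        (μ (X ⁻¹' (a • K + (1 - a) • L))).toReal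

/-- `X` is isotropic: centered with identity covariance matrix. -/
def IsIsotropic {n : ℕ} (μ : Measure Ω) (X : Ω → EuclideanSpace ℝ (Fin n)) : Prop :=
  (∀ i, ∫ ω, X ω i ∂μ = 0) ∧
  ∀ i j, ∫ ω, X ω i * X ω j ∂μ = if i = j then (1 : ℝ) else 0

/-- `σ_X(p) = sup_{|t| = 1} (E|⟨t,X⟩|^p)^(1/p)`. -/
def sigmaX {n : ℕ} (μ : Measure Ω) (X : Ω → EuclideanSpace ℝ (Fin n)) (p : ℝ) : ℝ :=
  ⨆ t : {t : EuclideanSpace ℝ (Fin n) // ‖t‖ = 1},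
    (∫ ω, |⟪t.1, X ω⟫| ^ p ∂μ) ^ (1 / p)

/-- Generalized inverse of `σ_X`. -/
def sigmaXInv {n : ℕ} (μ : Measure Ω) (X : Ω → EuclideanSpace ℝ (Fin n)) (s : ℝ) : ℝ :=
  sSup {p : ℝ | 1 ≤ p ∧ sigmaX μ X p ≤ s}

section GaussianConcentration

variable {E : Type*} [NormedAddCommGroup E] [InnerProductSpace ℝ E] [FiniteDimensional ℝ E]
  [MeasurableSpace E] [BorelSpace E]

omit [MeasurableSpace E] [BorelSpace E] in
lemma Seminorm.exists_supporting_functional (N : Seminorm ℝ E) (u : E) :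
    ∃ l : StrongDual ℝ E, l u = N u ∧ ∀ v, l v ≤ N v := by
  have hN : ∀ v, 0 ≤ N v := fun v => apply_nonneg N v
  rcases eq_or_ne u 0 with rfl | hu
  · exact ⟨0, by simp, hN⟩
  let f : E →ₗ.[ℝ] ℝ := LinearPMap.mkSpanSingleton u (N u) hu
  obtain ⟨g, hg, hle⟩ := exists_extension_of_le_sublinear f N
    (fun c hc x => by rw [map_smul_eq_mul, Real.norm_of_nonneg hc.le])
    (fun x y => map_add_le_add N x y)
    (by
      rintro ⟨x, hx⟩
      obtain ⟨c, rfl⟩ := Submodule.mem_span_singleton.1 hx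
      have : f ⟨c • u, hx⟩ = c * N u := LinearPMap.mkSpanSingleton'_apply _ _ _ _ _
      rw [this, map_smul_eq_mul]
      exact mul_le_mul_of_nonneg_right (le_abs_self c) (hN u))
  exact ⟨LinearMap.toContinuousLinearMap g,
    (hg ⟨u, Submodule.mem_span_singleton_self u⟩).trans
      (LinearPMap.mkSpanSingleton_apply ℝ _ hu (N u)), hle⟩

omit [FiniteDimensional ℝ E] [MeasurableSpace E] [BorelSpace E] in
lemma Seminorm.lipschitzWith_of_bound (N : Seminorm ℝ E) {σ : ℝ} (hσ : 0 ≤ σ)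
    (hN : ∀ x, N x ≤ σ * ‖x‖) : LipschitzWith σ.toNNReal N := by
  refine LipschitzWith.of_dist_le_mul fun x y => ?_
  rw [Real.dist_eq, Real.coe_toNNReal _ hσ, dist_eq_norm]
  exact (abs_sub_map_le_sub N x y).trans (hN _)

lemma stdGaussian_map_strongDual (l : StrongDual ℝ E) :
    (stdGaussian E).map l = gaussianReal 0 (‖l‖ ^ 2).toNNReal := by
  rw [IsGaussian.map_eq_gaussianReal, integral_strongDual_stdGaussian, variance_dual_stdGaussian]

lemma lintegral_exp_strongDual_stdGaussian (l : StrongDual ℝ E) (c : ℝ) :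
    ∫⁻ x, ENNReal.ofReal (exp (c * l x)) ∂(stdGaussian E) =
      ENNReal.ofReal (exp (c ^ 2 * ‖l‖ ^ 2 / 2)) := by
  have h := mgf_gaussianReal (stdGaussian_map_strongDual l) c
  have hi : Integrable (fun x => exp (c * l x)) (stdGaussian E) := by
    by_contra hcon
    rw [mgf, integral_undef hcon] at h
    exact (exp_pos _).ne h
  rw [← ofReal_integral_eq_lintegral_ofReal hi (ae_of_all _ fun x => (exp_pos _).le)]
  congr 1
  rw [mgf] at h
  rw [h, Real.coe_toNNReal _ (by positivity)]
  ring_nf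

lemma lintegral_exp_seminorm_lt_top (N : Seminorm ℝ E) {σ : ℝ}
    (hN : ∀ x, N x ≤ σ * ‖x‖) {a : ℝ} (ha : 0 ≤ a) :
    ∫⁻ x, ENNReal.ofReal (exp (a * N x)) ∂(stdGaussian E) < ⊤ := by
  obtain ⟨c, hc, hi⟩ := IsGaussian.exists_integrable_exp_sq (stdGaussian E)
  have hi2 : Integrable (fun x => exp ((a * σ) ^ 2 / (4 * c)) * exp (c * ‖x‖ ^ 2))
      (stdGaussian E) := hi.const_mul _
  refine lt_of_le_of_lt (lintegral_mono fun x => ENNReal.ofReal_le_ofReal ?_) hi2.lintegral_lt_top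
  rw [← exp_add]
  refine exp_le_exp.2 ?_
  have h1 : a * N x ≤ a * (σ * ‖x‖) := mul_le_mul_of_nonneg_left (hN x) ha
  have h2 : (a * σ) ^ 2 / (4 * c) + c * ‖x‖ ^ 2 - a * (σ * ‖x‖)
      = (a * σ - 2 * c * ‖x‖) ^ 2 / (4 * c) := by
    field_simp; ring
  have h3 : 0 ≤ (a * σ - 2 * c * ‖x‖) ^ 2 / (4 * c) := by positivity
  linarith

lemma lintegral_exp_seminorm_rotation_step (N : Seminorm ℝ E) {σ : ℝ} (hσ : 0 ≤ σ)
    (hN : ∀ x, N x ≤ σ * ‖x‖) {a δ : ℝ} (ha : 0 ≤ a) (hδ : 0 ≤ δ) (hδ' : δ ≤ π) :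
    ∫⁻ z, ENNReal.ofReal (exp (a * (N z.1 - N (cos δ • z.1 - sin δ • z.2))))
        ∂((stdGaussian E).prod (stdGaussian E)) ≤
      ENNReal.ofReal (exp ((a * δ) ^ 2 * σ ^ 2 / 2)) *
        ∫⁻ u, ENNReal.ofReal (exp (a * δ ^ 2 / 2 * N u)) ∂(stdGaussian E) := by
  have hcont : Continuous N := (N.lipschitzWith_of_bound hσ hN).continuous
  rw [lintegral_prod _ (by fun_prop), ← lintegral_const_mul _ (by fun_prop)]
  refine lintegral_mono fun u => ?_
  obtain ⟨l, hlu, hl⟩ := N.exists_supporting_functional u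
  have hlN : ‖l‖ ≤ σ := by
    refine l.opNorm_le_bound hσ fun x => ?_
    rw [Real.norm_eq_abs, abs_le]
    constructor
    · have := (hl (-x)).trans (hN (-x))
      rw [map_neg, norm_neg] at this
      linarith
    · exact (hl x).trans (hN x)
  have hcos := one_sub_sq_div_two_le_cos (x := δ)
  have hsin : 0 ≤ sin δ := sin_nonneg_of_nonneg_of_le_pi hδ hδ'
  have hsin' : sin δ ≤ δ := sin_le hδ
  calc ∫⁻ v, ENNReal.ofReal (exp (a * (N u - N (cos δ • u - sin δ • v)))) ∂(stdGaussian E)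
      ≤ ∫⁻ v, ENNReal.ofReal (exp (a * δ ^ 2 / 2 * N u)) *
          ENNReal.ofReal (exp ((a * sin δ) * l v)) ∂(stdGaussian E) := by
        refine lintegral_mono fun v => ?_
        rw [← ENNReal.ofReal_mul (exp_pos _).le, ← exp_add]
        refine ENNReal.ofReal_le_ofReal (exp_le_exp.2 ?_)
        have h1 := hl (cos δ • u - sin δ • v)
        rw [map_sub, map_smul, map_smul, smul_eq_mul, smul_eq_mul, hlu] at h1
        have h2 : 0 ≤ N u := apply_nonneg N u
        have h3 : N u - N (cos δ • u - sin δ • v) ≤ δ ^ 2 / 2 * N u + sin δ * l v := by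
          nlinarith
        nlinarith [mul_le_mul_of_nonneg_left h3 ha]
    _ = ENNReal.ofReal (exp (a * δ ^ 2 / 2 * N u)) *
          ENNReal.ofReal (exp ((a * sin δ) ^ 2 * ‖l‖ ^ 2 / 2)) := by
        rw [lintegral_const_mul _ (by fun_prop), lintegral_exp_strongDual_stdGaussian]
    _ ≤ _ := by
        rw [mul_comm]
        gcongr

lemma stdGaussian_prod_map_rotation (θ : ℝ) :
    ((stdGaussian E).prod (stdGaussian E)).map (ContinuousLinearMap.rotation θ) =
      (stdGaussian E).prod (stdGaussian E) :=
  IsGaussian.map_rotation_eq_self_of_forall_strongDual_eq_zero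
    (fun L => integral_strongDual_stdGaussian L) θ

/-- Maurey–Pisier type concentration: exponential moments of the difference of a seminorm at two
independent standard Gaussian vectors. -/
lemma lintegral_exp_seminorm_sub_le (N : Seminorm ℝ E) {σ : ℝ} (hσ : 0 ≤ σ)
    (hN : ∀ x, N x ≤ σ * ‖x‖) {a : ℝ} (ha : 0 ≤ a) :
    ∫⁻ z, ENNReal.ofReal (exp (a * (N z.2 - N z.1)))
        ∂((stdGaussian E).prod (stdGaussian E)) ≤
      2 * ENNReal.ofReal (exp (5 / 4 * a ^ 2 * σ ^ 2)) := by
  have hcont : Continuous N := (N.lipschitzWith_of_bound hσ hN).continuous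
  have hpi := pi_pos
  have hpi10 : π ^ 2 ≤ 10 := by nlinarith [pi_lt_d2]
  set b : ℝ := a * π ^ 2 / 8 with hb
  have hb0 : 0 ≤ b := by positivity
  set B := ∫⁻ x, ENNReal.ofReal (exp (b * N x)) ∂(stdGaussian E) with hB
  have hBtop : B < ⊤ := lintegral_exp_seminorm_lt_top N hN hb0
  obtain ⟨J, hJ⟩ := ENNReal.exists_nat_gt hBtop.ne
  have hJpos : 0 < J := by
    rcases Nat.eq_zero_or_pos J with h | h
    · simp [h] at hJ
    · exact h
  have hJ0 : (0 : ℝ) < J := by exact_mod_cast hJpos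
  have hJ1 : (1 : ℝ) ≤ J := by exact_mod_cast hJpos
  set δ : ℝ := π / (2 * J) with hδ
  have hδ0 : 0 ≤ δ := by positivity
  have hδpi : δ ≤ π := by
    rw [hδ, div_le_iff₀ (by positivity)]; nlinarith
  have hsmall : ∫⁻ u, ENNReal.ofReal (exp ((a * J) * δ ^ 2 / 2 * N u)) ∂(stdGaussian E) ≤ 2 := by
    calc ∫⁻ u, ENNReal.ofReal (exp ((a * J) * δ ^ 2 / 2 * N u)) ∂(stdGaussian E)
        ≤ ∫⁻ u, (1 + ENNReal.ofReal (1 / J) * ENNReal.ofReal (exp (b * N u)))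
            ∂(stdGaussian E) := by
          refine lintegral_mono fun u => ?_
          rw [← ENNReal.ofReal_mul (by positivity), ← ENNReal.ofReal_one,
            ← ENNReal.ofReal_add zero_le_one (by positivity)]
          refine ENNReal.ofReal_le_ofReal ?_
          have hconv := convexOn_exp.2 (Set.mem_univ 0) (Set.mem_univ (b * N u))
            (show (0 : ℝ) ≤ 1 - 1 / (J : ℝ) by rw [sub_nonneg, div_le_one hJ0]; exact hJ1)
            (show (0 : ℝ) ≤ 1 / (J : ℝ) by positivity) (by ring)
          simp only [smul_eq_mul, mul_zero, zero_add, exp_zero, mul_one] at hconv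
          have he : (a * J) * δ ^ 2 / 2 * N u = 1 / (J : ℝ) * (b * N u) := by
            rw [hδ, hb]; field_simp; ring
          rw [he]
          refine hconv.trans ?_
          have : 0 ≤ 1 / (J : ℝ) := by positivity
          linarith
      _ = 1 + ENNReal.ofReal (1 / J) * B := by
          rw [lintegral_add_left measurable_const, lintegral_const_mul _ (by fun_prop), ← hB]
          simp
      _ ≤ 1 + ENNReal.ofReal (1 / J) * J := by gcongr
      _ = 2 := by
          rw [← ENNReal.ofReal_natCast, ← ENNReal.ofReal_mul (by positivity)]
          rw [one_div, inv_mul_cancel₀ hJ0.ne', ENNReal.ofReal_one]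
          norm_num
  set R : ℕ → E × E → E × E := fun j => ContinuousLinearMap.rotation (j * δ) with hR
  have hR0 : ∀ z, (R 0 z).1 = z.1 := fun z => by
    simp [hR, ContinuousLinearMap.rotation_apply]
  have hRJ : ∀ z, (R J z).1 = z.2 := fun z => by
    have : (J : ℝ) * δ = π / 2 := by rw [hδ]; field_simp
    simp [hR, ContinuousLinearMap.rotation_apply, this]
  have hstep : ∀ j z, (R j z).1 = cos δ • (R (j + 1) z).1 - sin δ • (R (j + 1) z).2 := by
    intro j z
    simp only [hR, ContinuousLinearMap.rotation_apply]
    have h1 : (j : ℝ) * δ = ((j + 1 : ℕ) : ℝ) * δ - δ := by push_cast; ring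
    rw [h1, cos_sub, sin_sub]
    module
  set h : E × E → ℝ≥0∞ := fun z =>
    ENNReal.ofReal (exp ((a * J) * (N z.1 - N (cos δ • z.1 - sin δ • z.2)))) with hh
  have hhm : Measurable h := by fun_prop
  have hRm : ∀ j, Measurable (R j) := fun j => (ContinuousLinearMap.rotation _).continuous.measurable
  calc ∫⁻ z, ENNReal.ofReal (exp (a * (N z.2 - N z.1))) ∂((stdGaussian E).prod (stdGaussian E))
      ≤ ∫⁻ z, ∑ j ∈ Finset.range J, ENNReal.ofReal (1 / J) * h (R (j + 1) z)
          ∂((stdGaussian E).prod (stdGaussian E)) := by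
        refine lintegral_mono fun z => ?_
        have htel : N z.2 - N z.1 =
            ∑ j ∈ Finset.range J, (N (R (j + 1) z).1 - N (R j z).1) := by
          rw [Finset.sum_range_sub (fun j => N (R j z).1), hR0, hRJ]
        have hJen := convexOn_exp.map_sum_le (t := Finset.range J) (w := fun _ => 1 / (J : ℝ))
          (p := fun j => (a * J) * (N (R (j + 1) z).1 - N (R j z).1))
          (fun _ _ => by positivity) (by simp [hJ0.ne']) (fun _ _ => Set.mem_univ _)
        simp only [smul_eq_mul] at hJen
        have hl : a * (N z.2 - N z.1) = ∑ j ∈ Finset.range J,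
            1 / (J : ℝ) * ((a * J) * (N (R (j + 1) z).1 - N (R j z).1)) := by
          rw [htel, Finset.mul_sum]
          refine Finset.sum_congr rfl fun j _ => ?_
          field_simp
        rw [hl]
        refine (ENNReal.ofReal_le_ofReal hJen).trans ?_
        rw [ENNReal.ofReal_sum_of_nonneg (fun _ _ => by positivity)]
        refine Finset.sum_le_sum fun j _ => ?_
        rw [ENNReal.ofReal_mul (by positivity), hh]
        simp only
        rw [← hstep j z]
    _ = ∑ j ∈ Finset.range J, ENNReal.ofReal (1 / J) *
          ∫⁻ z, h z ∂((stdGaussian E).prod (stdGaussian E)) := by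
        have hm : ∀ j, Measurable fun z => h (R (j + 1) z) := fun j => hhm.comp (hRm (j + 1))
        rw [lintegral_finsetSum _ (fun j _ => (hm j).const_mul _)]
        refine Finset.sum_congr rfl fun j _ => ?_
        rw [lintegral_const_mul _ (hm j), ← lintegral_map hhm (hRm (j + 1))]
        rw [stdGaussian_prod_map_rotation]
    _ = ∫⁻ z, h z ∂((stdGaussian E).prod (stdGaussian E)) := by
        rw [Finset.sum_const, Finset.card_range, nsmul_eq_mul, ← mul_assoc,
          ← ENNReal.ofReal_natCast, ← ENNReal.ofReal_mul hJ0.le,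
          mul_one_div_cancel hJ0.ne', ENNReal.ofReal_one, one_mul]
    _ ≤ ENNReal.ofReal (exp ((a * J * δ) ^ 2 * σ ^ 2 / 2)) * 2 :=
        (lintegral_exp_seminorm_rotation_step N hσ hN (by positivity) hδ0 hδpi).trans
          (by gcongr)
    _ ≤ _ := by
        rw [mul_comm]
        gcongr
        have : a * J * δ = a * π / 2 := by rw [hδ]; field_simp
        rw [this]
        nlinarith [mul_nonneg (sq_nonneg a) (sq_nonneg σ)]

end GaussianConcentration

section GaussianTails

lemma ofReal_exp_integral_le {α : Type*} [MeasurableSpace α] {μ : Measure α}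
    [IsProbabilityMeasure μ] {g : α → ℝ} (hg : Integrable g μ) :
    ENNReal.ofReal (exp (∫ x, g x ∂μ)) ≤ ∫⁻ x, ENNReal.ofReal (exp (g x)) ∂μ := by
  by_cases h : ∫⁻ x, ENNReal.ofReal (exp (g x)) ∂μ = ⊤
  · simp [h]
  have hi : Integrable (fun x => exp (g x)) μ :=
    ⟨continuous_exp.comp_aestronglyMeasurable hg.1, by
      rw [hasFiniteIntegral_iff_ofReal (ae_of_all _ fun x => (exp_pos _).le)]
      exact lt_top_iff_ne_top.2 h⟩
  rw [← ofReal_integral_eq_lintegral_ofReal hi (ae_of_all _ fun x => (exp_pos _).le)]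
  exact ENNReal.ofReal_le_ofReal
    (convexOn_exp.map_integral_le continuous_exp.continuousOn isClosed_univ
      (ae_of_all _ fun _ => Set.mem_univ _) hg hi)

variable {E : Type*} [NormedAddCommGroup E] [InnerProductSpace ℝ E] [FiniteDimensional ℝ E]
  [MeasurableSpace E] [BorelSpace E]

lemma integrable_seminorm_stdGaussian (N : Seminorm ℝ E) {σ : ℝ} (hσ : 0 ≤ σ)
    (hN : ∀ x, N x ≤ σ * ‖x‖) : Integrable N (stdGaussian E) := by
  have hcont : Continuous N := (N.lipschitzWith_of_bound hσ hN).continuous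
  have h1 : Integrable (fun x : E => ‖x‖) (stdGaussian E) :=
    ((IsGaussian.memLp_id (stdGaussian E) 1 (by simp)).integrable le_rfl).norm
  refine (h1.const_mul σ).mono' hcont.aestronglyMeasurable (ae_of_all _ fun x => ?_)
  rw [Real.norm_of_nonneg (apply_nonneg N x)]
  exact hN x

lemma lintegral_exp_seminorm_sub_integral_le (N : Seminorm ℝ E) {σ : ℝ} (hσ : 0 ≤ σ)
    (hN : ∀ x, N x ≤ σ * ‖x‖) {a : ℝ} (ha : 0 ≤ a) :
    ∫⁻ x, ENNReal.ofReal (exp (a * (N x - ∫ y, N y ∂(stdGaussian E)))) ∂(stdGaussian E) ≤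
      2 * ENNReal.ofReal (exp (5 / 4 * a ^ 2 * σ ^ 2)) := by
  have hcont : Continuous N := (N.lipschitzWith_of_bound hσ hN).continuous
  have hi := integrable_seminorm_stdGaussian N hσ hN
  refine le_trans ?_ (lintegral_exp_seminorm_sub_le N hσ hN ha)
  rw [lintegral_prod_symm _ (by fun_prop)]
  refine lintegral_mono fun x => ?_
  have h := ofReal_exp_integral_le (((integrable_const (N x)).sub hi).const_mul a)
  refine le_trans (le_of_eq ?_) h
  congr 2
  rw [integral_const_mul]
  congr 1
  simp [integral_sub (integrable_const (N x)) hi]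

lemma lintegral_exp_integral_sub_seminorm_le (N : Seminorm ℝ E) {σ : ℝ} (hσ : 0 ≤ σ)
    (hN : ∀ x, N x ≤ σ * ‖x‖) {a : ℝ} (ha : 0 ≤ a) :
    ∫⁻ x, ENNReal.ofReal (exp (a * (∫ y, N y ∂(stdGaussian E) - N x))) ∂(stdGaussian E) ≤
      2 * ENNReal.ofReal (exp (5 / 4 * a ^ 2 * σ ^ 2)) := by
  have hcont : Continuous N := (N.lipschitzWith_of_bound hσ hN).continuous
  have hi := integrable_seminorm_stdGaussian N hσ hN
  refine le_trans ?_ (lintegral_exp_seminorm_sub_le N hσ hN ha)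
  rw [lintegral_prod _ (by fun_prop)]
  refine lintegral_mono fun x => ?_
  have h := ofReal_exp_integral_le ((hi.sub (integrable_const (N x))).const_mul a)
  refine le_trans (le_of_eq ?_) h
  congr 2
  rw [integral_const_mul]
  congr 1
  simp [integral_sub hi (integrable_const (N x))]

lemma measure_le_of_lintegral_exp_le {α : Type*} [MeasurableSpace α] {μ : Measure α} {g : α → ℝ}
    (hg : Measurable g) {σ s : ℝ} (hσ : 0 < σ) (hs : 0 ≤ s)
    (h : ∀ a : ℝ, 0 ≤ a → ∫⁻ x, ENNReal.ofReal (exp (a * g x)) ∂μ ≤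
      2 * ENNReal.ofReal (exp (5 / 4 * a ^ 2 * σ ^ 2))) :
    μ {x | s ≤ g x} ≤ ENNReal.ofReal (2 * exp (-(s ^ 2 / (5 * σ ^ 2)))) := by
  set a : ℝ := 2 * s / (5 * σ ^ 2) with ha
  have ha0 : 0 ≤ a := by positivity
  have h1 := (mul_meas_ge_le_lintegral (μ := μ)
    (f := fun x => ENNReal.ofReal (exp (a * g x))) (by fun_prop)
    (ENNReal.ofReal (exp (a * s)))).trans (h a ha0)
  have h2 : {x | s ≤ g x} ⊆
      {x | ENNReal.ofReal (exp (a * s)) ≤ ENNReal.ofReal (exp (a * g x))} := fun x hx =>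
    ENNReal.ofReal_le_ofReal (exp_le_exp.2 (mul_le_mul_of_nonneg_left hx ha0))
  have h3 : ENNReal.ofReal (exp (-(a * s))) * ENNReal.ofReal (exp (a * s)) = 1 := by
    rw [← ENNReal.ofReal_mul (exp_pos _).le, ← exp_add]; simp
  calc μ {x | s ≤ g x} ≤ μ {x | ENNReal.ofReal (exp (a * s)) ≤ ENNReal.ofReal (exp (a * g x))} :=
        measure_mono h2
    _ = ENNReal.ofReal (exp (-(a * s))) * (ENNReal.ofReal (exp (a * s)) *
          μ {x | ENNReal.ofReal (exp (a * s)) ≤ ENNReal.ofReal (exp (a * g x))}) := by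
        rw [← mul_assoc, h3, one_mul]
    _ ≤ ENNReal.ofReal (exp (-(a * s))) * (2 * ENNReal.ofReal (exp (5 / 4 * a ^ 2 * σ ^ 2))) := by
        gcongr
    _ = _ := by
        rw [mul_left_comm, ← ENNReal.ofReal_mul (exp_pos _).le, ← exp_add,
          ENNReal.ofReal_mul zero_le_two]
        congr 3
        · simp
        · rw [ha]; field_simp; ring

lemma stdGaussian_two_mul_integral_le_seminorm (N : Seminorm ℝ E) {σ : ℝ} (hσ : 0 < σ)
    (hN : ∀ x, N x ≤ σ * ‖x‖) {m : ℕ}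
    (hM : 400 * m * σ ^ 2 ≤ (∫ y, N y ∂(stdGaussian E)) ^ 2) :
    stdGaussian E {x | 2 * ∫ y, N y ∂(stdGaussian E) ≤ N x} ≤
      ENNReal.ofReal (2 * exp (-(20 * m))) := by
  have hcont : Continuous N := (N.lipschitzWith_of_bound hσ.le hN).continuous
  set M := ∫ y, N y ∂(stdGaussian E) with hMdef
  have hM0 : 0 ≤ M := integral_nonneg fun y => apply_nonneg N y
  have h := measure_le_of_lintegral_exp_le (μ := stdGaussian E) (g := fun x => N x - M)
    (by fun_prop) hσ hM0 (fun a ha => lintegral_exp_seminorm_sub_integral_le N hσ.le hN ha)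
  have he : {x | 2 * M ≤ N x} = {x | M ≤ N x - M} := by
    ext x; simp only [Set.mem_ofPred_eq]; constructor <;> intro h <;> linarith
  rw [he]
  refine h.trans (ENNReal.ofReal_le_ofReal ?_)
  gcongr
  rw [le_div_iff₀ (by positivity)]
  nlinarith [mul_nonneg (Nat.cast_nonneg (α := ℝ) m) (sq_nonneg σ)]

lemma stdGaussian_seminorm_le_half_integral (N : Seminorm ℝ E) {σ : ℝ} (hσ : 0 < σ)
    (hN : ∀ x, N x ≤ σ * ‖x‖) {m : ℕ}
    (hM : 400 * m * σ ^ 2 ≤ (∫ y, N y ∂(stdGaussian E)) ^ 2) :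
    stdGaussian E {x | N x ≤ (∫ y, N y ∂(stdGaussian E)) / 2} ≤
      ENNReal.ofReal (2 * exp (-(20 * m))) := by
  have hcont : Continuous N := (N.lipschitzWith_of_bound hσ.le hN).continuous
  set M := ∫ y, N y ∂(stdGaussian E) with hMdef
  have hM0 : 0 ≤ M := integral_nonneg fun y => apply_nonneg N y
  have h := measure_le_of_lintegral_exp_le (μ := stdGaussian E) (g := fun x => M - N x)
    (by fun_prop) hσ (s := M / 2) (by linarith)
    (fun a ha => lintegral_exp_integral_sub_seminorm_le N hσ.le hN ha)
  have he : {x | N x ≤ M / 2} = {x | M / 2 ≤ M - N x} := by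
    ext x; simp only [Set.mem_ofPred_eq]; constructor <;> intro h <;> linarith
  rw [he]
  refine h.trans (ENNReal.ofReal_le_ofReal ?_)
  gcongr
  rw [le_div_iff₀ (by positivity)]
  nlinarith [mul_nonneg (Nat.cast_nonneg (α := ℝ) m) (sq_nonneg σ)]

lemma lintegral_seminorm_pow_stdGaussian_le (N : Seminorm ℝ E) {σ : ℝ} (hσ : 0 ≤ σ)
    (hN : ∀ x, N x ≤ σ * ‖x‖) {m : ℕ} {M : ℝ} (hM0 : 0 < M)
    (hM : ∫ y, N y ∂(stdGaussian E) ≤ M) (hσM : 400 * m * σ ^ 2 ≤ M ^ 2) :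
    ∫⁻ x, ENNReal.ofReal (N x ^ m) ∂(stdGaussian E) ≤
      ENNReal.ofReal (2 * exp (2 * m) * M ^ m) := by
  have hcont : Continuous N := (N.lipschitzWith_of_bound hσ hN).continuous
  set M₀ := ∫ y, N y ∂(stdGaussian E) with hMdef
  set a : ℝ := m / M with ha
  have ha0 : 0 ≤ a := by positivity
  have haM : a * M = m := by rw [ha]; field_simp
  calc ∫⁻ x, ENNReal.ofReal (N x ^ m) ∂(stdGaussian E)
      ≤ ∫⁻ x, ENNReal.ofReal (M ^ m * exp m) * ENNReal.ofReal (exp (a * (N x - M₀)))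
          ∂(stdGaussian E) := by
        refine lintegral_mono fun x => ?_
        rw [← ENNReal.ofReal_mul (by positivity)]
        refine ENNReal.ofReal_le_ofReal ?_
        have h0 : 0 ≤ N x := apply_nonneg N x
        have h1 : N x ≤ M * exp (N x / M) := by
          have : N x / M ≤ exp (N x / M) := by linarith [add_one_le_exp (N x / M)]
          calc N x = M * (N x / M) := by field_simp
            _ ≤ _ := by gcongr
        calc N x ^ m ≤ (M * exp (N x / M)) ^ m := by gcongr
          _ = M ^ m * exp (a * N x) := by
            rw [mul_pow, ← exp_nat_mul, ha]; congr 2; ring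
          _ ≤ M ^ m * (exp m * exp (a * (N x - M₀))) := by
            rw [← exp_add]
            gcongr
            nlinarith
          _ = _ := by ring
    _ ≤ ENNReal.ofReal (M ^ m * exp m) * (2 * ENNReal.ofReal (exp (5 / 4 * a ^ 2 * σ ^ 2))) := by
        rw [lintegral_const_mul _ (by fun_prop)]
        gcongr
        exact lintegral_exp_seminorm_sub_integral_le N hσ hN ha0
    _ ≤ _ := by
        rw [← ENNReal.ofReal_ofNat 2, ← ENNReal.ofReal_mul (by positivity),
          ← ENNReal.ofReal_mul (by positivity)]
        refine ENNReal.ofReal_le_ofReal ?_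
        have h5 : 5 / 4 * a ^ 2 * σ ^ 2 ≤ m := by
          have : a ^ 2 * σ ^ 2 * 400 ≤ m := by
            rcases Nat.eq_zero_or_pos m with h | h
            · simp [ha, h]
            have hm : (0 : ℝ) < m := by exact_mod_cast h
            have h6 : a ^ 2 * (400 * m * σ ^ 2) ≤ (m : ℝ) ^ 2 := by
              calc a ^ 2 * (400 * m * σ ^ 2) ≤ a ^ 2 * M ^ 2 := by gcongr
                _ = (m : ℝ) ^ 2 := by rw [← mul_pow, haM]
            nlinarith
          nlinarith [mul_nonneg (sq_nonneg a) (sq_nonneg σ)]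
        calc M ^ m * exp m * (2 * exp (5 / 4 * a ^ 2 * σ ^ 2))
            ≤ M ^ m * exp m * (2 * exp m) := by gcongr
          _ = _ := by rw [show (2 : ℝ) * m = m + m by ring, exp_add]; ring

end GaussianTails

section LogConcaveMeasures

/-- Log-concavity of a measure, tested on closed sets. -/
def LogConcaveOnClosed {E : Type*} [TopologicalSpace E] [AddCommGroup E] [Module ℝ E]
    [MeasurableSpace E] (ν : Measure E) : Prop :=
  ∀ A B C : Set E, IsClosed A → IsClosed B → IsClosed C → ∀ a : ℝ, 0 < a → a < 1 →
    (∀ x ∈ A, ∀ y ∈ B, a • x + (1 - a) • y ∈ C) →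
      ν.real A ^ a * ν.real B ^ (1 - a) ≤ ν.real C

lemma tendsto_measureReal_inter_closedBall {E : Type*} [NormedAddCommGroup E] [MeasurableSpace E]
    (ν : Measure E) [IsFiniteMeasure ν] (A : Set E) :
    Filter.Tendsto (fun k : ℕ => ν.real (A ∩ Metric.closedBall 0 k)) Filter.atTop
      (nhds (ν.real A)) := by
  have h := tendsto_measure_iUnion_atTop (μ := ν)
    (s := fun k : ℕ => A ∩ Metric.closedBall (0 : E) k) (fun i j hij =>
      Set.inter_subset_inter_right _ (Metric.closedBall_subset_closedBall (by exact_mod_cast hij)))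
  rw [← Set.inter_iUnion, Metric.iUnion_closedBall_nat, Set.inter_univ] at h
  exact (ENNReal.tendsto_toReal (measure_ne_top ν A)).comp h

lemma IsLogConcave.logConcaveOnClosed {n : ℕ} {μ : Measure Ω}
    [IsProbabilityMeasure μ] {X : Ω → EuclideanSpace ℝ (Fin n)} (hX : Measurable X)
    (h : IsLogConcave μ X) : LogConcaveOnClosed (μ.map X) := by
  have : IsProbabilityMeasure (μ.map X) := Measure.isProbabilityMeasure_map hX.aemeasurable
  intro A B C hA hB hC a ha0 ha1 hABC
  have hlim := ((tendsto_measureReal_inter_closedBall (μ.map X) A).rpow_const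
    (p := a) (Or.inr ha0.le)).mul ((tendsto_measureReal_inter_closedBall (μ.map X) B).rpow_const
    (p := 1 - a) (Or.inr (by linarith)))
  refine le_of_tendsto' hlim fun k => ?_
  set K := A ∩ Metric.closedBall (0 : EuclideanSpace ℝ (Fin n)) k with hK
  set L := B ∩ Metric.closedBall (0 : EuclideanSpace ℝ (Fin n)) k with hL
  have hKc : IsCompact K := (isCompact_closedBall _ _).inter_left hA
  have hLc : IsCompact L := (isCompact_closedBall _ _).inter_left hB
  rcases K.eq_empty_or_nonempty with h0 | hKn
  · rw [h0, measureReal_empty, zero_rpow ha0.ne', zero_mul]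
    exact measureReal_nonneg
  rcases L.eq_empty_or_nonempty with h0 | hLn
  · rw [h0, measureReal_empty, zero_rpow (by linarith), mul_zero]
    exact measureReal_nonneg
  have h1 := h K L hKn hLn hKc hLc a ha0.le ha1.le
  have h2 : ∀ S : Set (EuclideanSpace ℝ (Fin n)), IsClosed S →
      (μ.map X).real S = (μ (X ⁻¹' S)).toReal := fun S hS => by
    rw [measureReal_def, Measure.map_apply hX hS.measurableSet]
  rw [h2 K hKc.isClosed, h2 L hLc.isClosed, h2 C hC]
  refine h1.trans (ENNReal.toReal_mono (measure_ne_top _ _) (measure_mono ?_))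
  refine Set.preimage_mono ?_
  rintro _ ⟨_, ⟨x, hx, rfl⟩, _, ⟨y, hy, rfl⟩, rfl⟩
  exact hABC x hx.1 y hy.1

lemma LogConcaveOnClosed.map {E F : Type*} [NormedAddCommGroup E] [NormedSpace ℝ E]
    [MeasurableSpace E] [BorelSpace E] [NormedAddCommGroup F] [NormedSpace ℝ F]
    [MeasurableSpace F] [BorelSpace F] {ν : Measure E} (h : LogConcaveOnClosed ν)
    (T : E →L[ℝ] F) : LogConcaveOnClosed (ν.map T) := by
  intro A B C hA hB hC a ha0 ha1 hABC
  have h2 : ∀ S : Set F, IsClosed S → (ν.map T).real S = ν.real (T ⁻¹' S) := fun S hS =>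
    map_measureReal_apply T.continuous.measurable hS.measurableSet
  rw [h2 A hA, h2 B hB, h2 C hC]
  refine h _ _ _ (hA.preimage T.continuous) (hB.preimage T.continuous) (hC.preimage T.continuous)
    a ha0 ha1 fun x hx y hy => ?_
  simpa using hABC _ hx _ hy

variable {ρ : Measure ℝ} [IsProbabilityMeasure ρ]

lemma LogConcaveOnClosed.measureReal_Ici_le (h : LogConcaveOnClosed ρ) {s κ : ℝ} (hs : 0 < s)
    (hκ : 0 ≤ κ) (hρ : ρ.real {x | s ≤ |x|} ≤ exp (-κ) / 2) {u : ℝ} (hu : 1 < u) :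
    ρ.real {x | u * s ≤ x} ≤ exp (-(κ * (u + 1) / 2)) := by
  set a : ℝ := 2 / (u + 1) with ha
  have ha0 : 0 < a := by positivity
  have ha1 : a < 1 := by rw [ha, div_lt_one (by linarith)]; linarith
  have h1 := h {x | u * s ≤ x} {x | -s ≤ x} {x | s ≤ x}
    (isClosed_le continuous_const continuous_id) (isClosed_le continuous_const continuous_id)
    (isClosed_le continuous_const continuous_id) a ha0 ha1 (by
      intro x hx y hy
      simp only [Set.mem_ofPred_eq, smul_eq_mul] at *
      have e : s = a * (u * s) + (1 - a) * (-s) := by rw [ha]; field_simp; ring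
      calc s = a * (u * s) + (1 - a) * (-s) := e
        _ ≤ _ := by
          have : 0 ≤ 1 - a := by linarith
          gcongr)
  have h2 : ρ.real {x | s ≤ x} ≤ exp (-κ) / 2 :=
    (measureReal_mono (fun x (hx : s ≤ x) => hx.trans (le_abs_self x))).trans hρ
  have he : exp (-κ) ≤ 1 := exp_le_one_iff.2 (by linarith)
  have h3 : 1 / 2 ≤ ρ.real {x | -s ≤ x} := by
    have h4 : ρ.real {x | -s ≤ x}ᶜ ≤ exp (-κ) / 2 := by
      refine (measureReal_mono (fun x hx => ?_)).trans hρ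
      simp only [Set.mem_compl_iff, Set.mem_ofPred_eq, not_le] at *
      exact (by linarith : s ≤ -x).trans (neg_le_abs x)
    rw [probReal_compl_eq_one_sub (show MeasurableSet {x : ℝ | -s ≤ x} from measurableSet_Ici)] at h4
    linarith
  have h5 : 1 / 2 ≤ ρ.real {x | -s ≤ x} ^ (1 - a) := by
    have hle1 : ρ.real {x | -s ≤ x} ≤ 1 := measureReal_le_one
    calc (1 : ℝ) / 2 ≤ ρ.real {x | -s ≤ x} ^ (1 : ℝ) := by rwa [rpow_one]
      _ ≤ _ := rpow_le_rpow_of_exponent_ge (by linarith) hle1 (by linarith)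
  have h6 : ρ.real {x | u * s ≤ x} ^ a ≤ exp (-κ) := by
    have h7 : 0 ≤ ρ.real {x | u * s ≤ x} ^ a := rpow_nonneg measureReal_nonneg _
    nlinarith
  have h8 := rpow_le_rpow (rpow_nonneg measureReal_nonneg _) h6 (show 0 ≤ a⁻¹ by positivity)
  rw [rpow_rpow_inv measureReal_nonneg ha0.ne', ← exp_mul] at h8
  refine h8.trans (le_of_eq ?_)
  congr 1
  rw [ha]; field_simp

lemma LogConcaveOnClosed.measureReal_abs_le (h : LogConcaveOnClosed ρ) {s κ : ℝ} (hs : 0 < s)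
    (hκ : 0 ≤ κ) (hρ : ρ.real {x | s ≤ |x|} ≤ exp (-κ) / 2) {u : ℝ} (hu : 1 ≤ u) :
    ρ.real {x | u * s ≤ |x|} ≤ 2 * exp (-(κ * (u + 1) / 2)) := by
  rcases hu.eq_or_lt with rfl | hu
  · rw [one_mul]
    refine hρ.trans ?_
    rw [show κ * (1 + 1) / 2 = κ by ring]
    linarith [exp_pos (-κ)]
  have hneg : ∀ S : Set ℝ, IsClosed S →
      (ρ.map (-ContinuousLinearMap.id ℝ ℝ)).real S = ρ.real {x | -x ∈ S} :=
    fun S hS => map_measureReal_apply (ContinuousLinearMap.continuous _).measurable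
      hS.measurableSet
  have : IsProbabilityMeasure (ρ.map (-ContinuousLinearMap.id ℝ ℝ)) :=
    Measure.isProbabilityMeasure_map (ContinuousLinearMap.continuous _).aemeasurable
  have h1 := h.measureReal_Ici_le hs hκ hρ hu
  have h2 := (h.map (-ContinuousLinearMap.id ℝ ℝ)).measureReal_Ici_le hs hκ (by
    rw [hneg _ (isClosed_le continuous_const continuous_abs)]
    simpa using hρ) hu
  rw [hneg _ (show IsClosed {x : ℝ | u * s ≤ x} from isClosed_Ici)] at h2
  have h3 : {x | u * s ≤ |x|} ⊆ {x | u * s ≤ x} ∪ {x | -x ∈ {y | u * s ≤ y}} := fun x hx => by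
    simp only [Set.mem_ofPred_eq, Set.mem_union] at *
    exact le_abs.1 hx
  have := (measureReal_mono h3).trans (measureReal_union_le (μ := ρ) _ _)
  linarith

lemma LogConcaveOnClosed.lintegral_abs_pow_le (h : LogConcaveOnClosed ρ) {s : ℝ} (hs : 0 < s)
    {q : ℕ} (hq : 1 ≤ q) (hρ : ρ.real {x | s ≤ |x|} ≤ exp (-(4 * q)) / 2) :
    ∫⁻ x, ENNReal.ofReal (|x| ^ q) ∂ρ ≤ ENNReal.ofReal (3 * s ^ q) := by
  have hq' : (1 : ℝ) ≤ q := by exact_mod_cast hq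
  set S : ℕ → Set ℝ := fun i => {x | ((i : ℝ) + 1) * s ≤ |x|} with hS
  have hSm : ∀ i, MeasurableSet (S i) := fun i =>
    measurableSet_le measurable_const continuous_abs.measurable
  have hpt : ∀ x : ℝ, ENNReal.ofReal (|x| ^ q) ≤ ENNReal.ofReal (s ^ q) *
      (1 + ∑' i : ℕ, (S i).indicator (fun _ => ENNReal.ofReal (((i : ℝ) + 2) ^ q)) x) := by
    intro x
    set j := ⌊|x| / s⌋₊ with hj
    have hxj : |x| / s < j + 1 := Nat.lt_floor_add_one _
    have hjx : (j : ℝ) ≤ |x| / s := Nat.floor_le (by positivity)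
    have hx : |x| ^ q = s ^ q * (|x| / s) ^ q := by rw [← mul_pow]; congr 1; field_simp
    rw [hx, ENNReal.ofReal_mul (by positivity)]
    gcongr
    rcases j with _ | i
    · refine le_add_right ?_
      rw [← ENNReal.ofReal_one]
      refine ENNReal.ofReal_le_ofReal (pow_le_one₀ (by positivity) ?_)
      simp only [Nat.cast_zero, zero_add] at hxj
      exact hxj.le
    · refine le_add_left (le_trans ?_ (ENNReal.le_tsum i))
      have hmem : x ∈ S i := by
        simp only [hS, Set.mem_ofPred_eq]
        rw [← le_div_iff₀ hs]; push_cast at hjx; exact hjx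
      rw [Set.indicator_of_mem hmem]
      refine ENNReal.ofReal_le_ofReal (pow_le_pow_left₀ (by positivity) ?_ _)
      push_cast at hxj
      linarith
  have hterm : ∀ i : ℕ, ∫⁻ x, (S i).indicator (fun _ => ENNReal.ofReal (((i : ℝ) + 2) ^ q)) x ∂ρ ≤
      (2 : ℝ≥0∞)⁻¹ ^ i := by
    intro i
    rw [lintegral_indicator_const (hSm i), ← ofReal_measureReal, ← ENNReal.ofReal_mul (by positivity)]
    have h1 : ρ.real (S i) ≤ 2 * exp (-(4 * q * (((i : ℝ) + 1) + 1) / 2)) :=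
      h.measureReal_abs_le hs (by positivity) hρ (by linarith [(Nat.cast_nonneg i : (0 : ℝ) ≤ i)])
    have h2 : ((i : ℝ) + 2) ^ q ≤ exp (q * ((i : ℝ) + 1)) := by
      rw [exp_nat_mul]
      refine pow_le_pow_left₀ (by positivity) ?_ _
      linarith [add_one_le_exp ((i : ℝ) + 1)]
    have h3 : (2 : ℝ≥0∞)⁻¹ ^ i = ENNReal.ofReal ((1 / 2) ^ i) := by
      rw [ENNReal.ofReal_pow (by norm_num), one_div, ENNReal.ofReal_inv_of_pos (by norm_num)]
      simp
    rw [h3]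
    refine ENNReal.ofReal_le_ofReal ?_
    calc ((i : ℝ) + 2) ^ q * ρ.real (S i)
        ≤ exp (q * ((i : ℝ) + 1)) * (2 * exp (-(4 * q * (((i : ℝ) + 1) + 1) / 2))) := by gcongr
      _ = 2 * exp (-(q * ((i : ℝ) + 3))) := by
        rw [mul_left_comm, ← exp_add]; congr 2; ring
      _ ≤ 2 * exp (-(i + 3)) := by
        gcongr
        nlinarith [(Nat.cast_nonneg i : (0 : ℝ) ≤ i)]
      _ = 2 * exp (-1) ^ (i + 3) := by
        rw [← exp_nat_mul]; push_cast; congr 2; ring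
      _ ≤ 2 * (1 / 2) ^ (i + 3) := by
        gcongr
        rw [exp_neg, one_div]
        gcongr
        linarith [add_one_le_exp (1 : ℝ)]
      _ ≤ (1 / 2) ^ i := by
        rw [pow_add]
        have : (0 : ℝ) ≤ (1 / 2) ^ i := by positivity
        norm_num
        linarith
  calc ∫⁻ x, ENNReal.ofReal (|x| ^ q) ∂ρ
      ≤ ∫⁻ x, ENNReal.ofReal (s ^ q) *
        (1 + ∑' i : ℕ, (S i).indicator (fun _ => ENNReal.ofReal (((i : ℝ) + 2) ^ q)) x) ∂ρ :=
        lintegral_mono hpt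
    _ = ENNReal.ofReal (s ^ q) * (1 + ∑' i : ℕ,
          ∫⁻ x, (S i).indicator (fun _ => ENNReal.ofReal (((i : ℝ) + 2) ^ q)) x ∂ρ) := by
        have hm : ∀ i : ℕ, Measurable
            ((S i).indicator fun _ => ENNReal.ofReal (((i : ℝ) + 2) ^ q)) :=
          fun i => measurable_const.indicator (hSm i)
        have hm' : Measurable fun x => ∑' i : ℕ,
            (S i).indicator (fun _ => ENNReal.ofReal (((i : ℝ) + 2) ^ q)) x :=
          Measurable.tsum hm
        rw [lintegral_const_mul _ (hm'.const_add 1),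
          lintegral_add_left measurable_const, lintegral_tsum fun i => (hm i).aemeasurable]
        simp
    _ ≤ ENNReal.ofReal (s ^ q) * (1 + 2) := by
        gcongr
        rw [← ENNReal.tsum_geometric_two]
        exact ENNReal.tsum_le_tsum hterm
    _ = _ := by
        rw [ENNReal.ofReal_mul (by norm_num), mul_comm]
        norm_num

lemma LogConcaveOnClosed.lintegral_abs_pow_lt_top (h : LogConcaveOnClosed ρ) {q : ℕ}
    (hq : 1 ≤ q) : ∫⁻ x, ENNReal.ofReal (|x| ^ q) ∂ρ < ⊤ := by
  have h1 := tendsto_measureReal_inter_closedBall ρ Set.univ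
  simp only [Set.univ_inter, probReal_univ] at h1
  have hpos := exp_pos (-(4 * (q : ℝ)))
  obtain ⟨k, hk⟩ := ((h1.eventually_const_lt
    (show 1 - exp (-(4 * (q : ℝ))) / 2 < 1 by linarith)).and (Filter.eventually_ge_atTop 1)).exists
  refine (h.lintegral_abs_pow_le (s := k + 1) (by positivity) hq ?_).trans_lt ENNReal.ofReal_lt_top
  have h2 := hk.1
  have h3 : ρ.real (Metric.closedBall (0 : ℝ) k)ᶜ ≤ exp (-(4 * q)) / 2 := by
    rw [probReal_compl_eq_one_sub Metric.isClosed_closedBall.measurableSet]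
    linarith
  refine (measureReal_mono fun x hx => ?_).trans h3
  simp only [Set.mem_compl_iff, Set.mem_ofPred_eq, Metric.mem_closedBall, dist_zero_right,
    Real.norm_eq_abs, not_le] at *
  linarith

end LogConcaveMeasures

section Slicing

variable {F : Type*} [NormedAddCommGroup F] [InnerProductSpace ℝ F] [FiniteDimensional ℝ F]
  [MeasurableSpace F] [BorelSpace F] {ν : Measure F} [IsProbabilityMeasure ν]

open Metric Module

omit [FiniteDimensional ℝ F] [BorelSpace F] [IsProbabilityMeasure ν] in
lemma LogConcaveOnClosed.measureReal_closedBall (h : LogConcaveOnClosed ν) {a : ℝ} (ha0 : 0 < a)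
    (ha1 : a < 1) (x y : F) (R : ℝ) :
    ν.real (closedBall x R) ^ a * ν.real (closedBall y R) ^ (1 - a) ≤
      ν.real (closedBall (a • x + (1 - a) • y) R) := by
  refine h _ _ _ isClosed_closedBall isClosed_closedBall isClosed_closedBall a ha0 ha1 ?_
  intro u hu v hv
  rw [mem_closedBall, dist_eq_norm] at *
  have e : a • u + (1 - a) • v - (a • x + (1 - a) • y) = a • (u - x) + (1 - a) • (v - y) := by
    module
  rw [e]
  calc ‖a • (u - x) + (1 - a) • (v - y)‖ ≤ ‖a • (u - x)‖ + ‖(1 - a) • (v - y)‖ := norm_add_le _ _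
    _ = a * ‖u - x‖ + (1 - a) * ‖v - y‖ := by
      rw [norm_smul, norm_smul, Real.norm_of_nonneg ha0.le,
        Real.norm_of_nonneg (by linarith : 0 ≤ 1 - a)]
    _ ≤ a * R + (1 - a) * R := by
      have : 0 ≤ 1 - a := by linarith
      gcongr
    _ = R := by ring

omit [FiniteDimensional ℝ F] [BorelSpace F] [IsProbabilityMeasure ν] in
lemma LogConcaveOnClosed.sqrt_mul_le_midpoint (h : LogConcaveOnClosed ν) (x y : F) (R : ℝ) :
    √(ν.real (closedBall x R) * ν.real (closedBall y R)) ≤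
      ν.real (closedBall ((1 / 2 : ℝ) • (x + y)) R) := by
  have h1 := h.measureReal_closedBall (a := 1 / 2) (by norm_num) (by norm_num) x y R
  have e : (1 / 2 : ℝ) • x + (1 - 1 / 2 : ℝ) • y = (1 / 2 : ℝ) • (x + y) := by
    rw [smul_add]; norm_num
  rw [e, show (1 - 1 / 2 : ℝ) = 1 / 2 by norm_num, ← mul_rpow measureReal_nonneg measureReal_nonneg,
    ← sqrt_eq_rpow] at h1
  exact h1

omit [FiniteDimensional ℝ F] [BorelSpace F] [IsProbabilityMeasure ν] in
lemma LogConcaveOnClosed.convex_superlevel (h : LogConcaveOnClosed ν) (R : ℝ) {δ : ℝ}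
    (hδ : 0 < δ) : Convex ℝ {x | δ ≤ ν.real (closedBall x R)} := by
  rw [convex_iff_forall_pos]
  intro x hx y hy a b ha hb hab
  obtain rfl : b = 1 - a := by linarith
  simp only [Set.mem_ofPred_eq] at *
  calc δ = δ ^ a * δ ^ (1 - a) := by rw [← rpow_add hδ]; simp
    _ ≤ ν.real (closedBall x R) ^ a * ν.real (closedBall y R) ^ (1 - a) := by gcongr
    _ ≤ _ := h.measureReal_closedBall ha (by linarith) x y R

omit [InnerProductSpace ℝ F] [FiniteDimensional ℝ F] [IsProbabilityMeasure ν] in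
lemma measurable_measure_closedBall [SecondCountableTopology F] [SFinite ν] (R : ℝ) :
    Measurable fun x => ν (closedBall x R) := by
  have : MeasurableSet {p : F × F | dist p.2 p.1 ≤ R} :=
    (isClosed_le (continuous_snd.dist continuous_fst) continuous_const).measurableSet
  exact measurable_measure_prodMk_left this

lemma lintegral_measure_closedBall_smul {c : ℝ} (hc : 0 < c) (R : ℝ) :
    ∫⁻ x, ν (closedBall (c • x) R) = volume (closedBall (0 : F) (R / c)) := by
  have hS : MeasurableSet {p : F × F | dist p.2 (c • p.1) ≤ R} :=
    (isClosed_le (by fun_prop) continuous_const).measurableSet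
  have h1 := Measure.prod_apply (μ := (volume : Measure F)) (ν := ν) hS
  have h2 := Measure.prod_apply_symm (μ := (volume : Measure F)) (ν := ν) hS
  have h3 : ∀ y : F, (fun x => (x, y)) ⁻¹' {p : F × F | dist p.2 (c • p.1) ≤ R} =
      closedBall (c⁻¹ • y) (R / c) := fun y => by
    ext x
    simp only [Set.mem_preimage, Set.mem_ofPred_eq, mem_closedBall]
    rw [le_div_iff₀ hc]
    have : y = c • (c⁻¹ • y) := by rw [smul_smul, mul_inv_cancel₀ hc.ne', one_smul]
    rw [dist_comm, dist_eq_norm, dist_eq_norm]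
    nth_rw 1 [this]
    rw [← smul_sub, norm_smul, Real.norm_of_nonneg hc.le, mul_comm]
  simp_rw [h3, Measure.addHaar_closedBall_center] at h2
  rw [lintegral_const, measure_univ, mul_one] at h2
  rw [← h2, h1]
  rfl

lemma LogConcaveOnClosed.measure_half_difference_le (h : LogConcaveOnClosed ν) {r δ : ℝ}
    (hδ : 0 < δ) (hν : 1 / 2 ≤ ν.real (closedBall 0 r)) :
    ENNReal.ofReal (δ / 2) * volume (closedBall (0 : F) (r / 2)) *
      volume ((1 / 2 : ℝ) • ({x | δ ≤ ν.real (closedBall x (2 * r))} -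
        {x | δ ≤ ν.real (closedBall x (2 * r))})) ≤
      volume (closedBall (0 : F) (2 * r)) * volume (closedBall (0 : F) (2 * r)) := by
  set f : F → ℝ≥0∞ := fun x => ν (closedBall x (2 * r)) with hf
  have hfm : Measurable f := measurable_measure_closedBall _
  have hof : ∀ x, f x = ENNReal.ofReal (ν.real (closedBall x (2 * r))) := fun x => by
    rw [ofReal_measureReal]
  have hfint : ∫⁻ x, f x = volume (closedBall (0 : F) (2 * r)) := by
    have := lintegral_measure_closedBall_smul (ν := ν) one_pos (2 * r)
    simpa using this
  have hhalf : ∀ y : F, ‖y‖ ≤ r → 1 / 2 ≤ ν.real (closedBall y (2 * r)) := fun y hy =>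
    hν.trans (measureReal_mono (closedBall_subset_closedBall' (by
      rw [dist_zero_left]; linarith)))
  have hmid : ∀ x w : F, δ ≤ ν.real (closedBall x (2 * r)) → ‖w‖ ≤ r / 2 →
      √(δ / 2) ≤ ν.real (closedBall ((1 / 2 : ℝ) • x + w) (2 * r)) := fun x w hx hw => by
    have h1 := h.sqrt_mul_le_midpoint x ((2 : ℝ) • w) (2 * r)
    have h2 : ‖(2 : ℝ) • w‖ ≤ r := by
      rw [norm_smul]; norm_num; linarith
    have e : (1 / 2 : ℝ) • (x + (2 : ℝ) • w) = (1 / 2 : ℝ) • x + w := by module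
    rw [e] at h1
    refine le_trans (sqrt_le_sqrt ?_) h1
    have := hhalf _ h2
    nlinarith
  set Ψ : F → ℝ≥0∞ := fun z => ∫⁻ u, f u * f (u - z) with hΨ
  have hm2 : Measurable fun p : F × F => f p.2 * f (p.2 - p.1) :=
    (hfm.comp measurable_snd).mul (hfm.comp (measurable_snd.sub measurable_fst))
  have hΨm : Measurable Ψ := hm2.lintegral_prod_right'
  have hΨint : ∫⁻ z, Ψ z =
      volume (closedBall (0 : F) (2 * r)) * volume (closedBall (0 : F) (2 * r)) := by
    rw [hΨ, lintegral_lintegral_swap hm2.aemeasurable]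
    have : ∀ u : F, ∫⁻ z, f u * f (u - z) = f u * volume (closedBall (0 : F) (2 * r)) :=
      fun u => by
      have hm3 : Measurable fun z => f (u - z) := hfm.comp (measurable_const.sub measurable_id)
      rw [lintegral_const_mul _ hm3, lintegral_sub_left_eq_self f u, hfint]
    simp_rw [this]
    rw [lintegral_mul_const _ hfm, hfint]
  rw [← hΨint]
  refine le_trans ?_ (mul_meas_ge_le_lintegral hΨm
    (ENNReal.ofReal (δ / 2) * volume (closedBall (0 : F) (r / 2))))
  gcongr
  rintro _ ⟨_, ⟨x, hx, x', hx', rfl⟩, rfl⟩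
  simp only [Set.mem_ofPred_eq] at hx hx' ⊢
  rw [hΨ]
  calc ENNReal.ofReal (δ / 2) * volume (closedBall (0 : F) (r / 2))
      = ENNReal.ofReal (δ / 2) * volume (closedBall ((1 / 2 : ℝ) • x) (r / 2)) := by
        rw [Measure.addHaar_closedBall_center volume ((1 / 2 : ℝ) • x)]
    _ = ∫⁻ u in closedBall ((1 / 2 : ℝ) • x) (r / 2), ENNReal.ofReal (δ / 2) := by
        rw [setLIntegral_const]
    _ ≤ ∫⁻ u in closedBall ((1 / 2 : ℝ) • x) (r / 2),
          f u * f (u - (1 / 2 : ℝ) • (x - x')) := by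
        refine setLIntegral_mono (hfm.mul (hfm.comp (measurable_id.sub_const _))) fun u hu => ?_
        rw [mem_closedBall, dist_eq_norm] at hu
        have h1 := hmid x (u - (1 / 2 : ℝ) • x) hx hu
        have h2 := hmid x' (u - (1 / 2 : ℝ) • x) hx' hu
        rw [show (1 / 2 : ℝ) • x + (u - (1 / 2 : ℝ) • x) = u by module] at h1
        rw [show (1 / 2 : ℝ) • x' + (u - (1 / 2 : ℝ) • x) = u - (1 / 2 : ℝ) • (x - x') by
          module] at h2
        rw [hof, hof, ← ENNReal.ofReal_mul measureReal_nonneg]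
        refine ENNReal.ofReal_le_ofReal ?_
        calc δ / 2 = √(δ / 2) * √(δ / 2) := (mul_self_sqrt (by positivity)).symm
          _ ≤ _ := mul_le_mul h1 h2 (sqrt_nonneg _) measureReal_nonneg
    _ ≤ _ := setLIntegral_le_lintegral _ _

lemma LogConcaveOnClosed.exists_direction_bounding_superlevel (h : LogConcaveOnClosed ν) {r δ : ℝ}
    (hr : 0 < r) (hδ : 0 < δ) (hδ' : δ ≤ 1 / 2) (hν : 1 / 2 ≤ ν.real (closedBall 0 r)) {ρ : ℝ}
    (hρ0 : 0 ≤ ρ) (hρ : 2 * (8 * r) ^ finrank ℝ F < δ * ρ ^ finrank ℝ F) :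
    ∃ t : F, ‖t‖ = 1 ∧ ∀ x, δ ≤ ν.real (closedBall x (2 * r)) → |⟪t, x⟫| ≤ 2 * ρ := by
  set D : Set F := {x | δ ≤ ν.real (closedBall x (2 * r))} with hD
  set Q : Set F := (1 / 2 : ℝ) • (D - D) with hQ
  have hconv : Convex ℝ D := h.convex_superlevel _ hδ
  have hQconv : Convex ℝ Q := (hconv.sub hconv).smul _
  have h0D : (0 : F) ∈ D := by
    simp only [hD, Set.mem_ofPred_eq]
    exact hδ'.trans (hν.trans (measureReal_mono (closedBall_subset_closedBall (by linarith))))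
  have hmem : ∀ x ∈ D, ∀ y ∈ D, (1 / 2 : ℝ) • (x - y) ∈ closure Q := fun x hx y hy =>
    subset_closure (Set.smul_mem_smul_set (Set.sub_mem_sub hx hy))
  have hvol := h.measure_half_difference_le hδ hν
  rw [← hD, ← hQ] at hvol
  have hclos : volume (closure Q) ≤ volume Q := by
    rw [closure_eq_self_union_frontier]
    refine (measure_union_le _ _).trans ?_
    rw [hQconv.addHaar_frontier volume, add_zero]
  obtain ⟨w, hw, hwQ⟩ : ∃ w ∈ closedBall (0 : F) ρ, w ∉ closure Q := by
    by_contra! hcon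
    have h1 : volume (closedBall (0 : F) ρ) ≤ volume Q := (measure_mono hcon).trans hclos
    have h2 := (mul_le_mul_right h1
      (ENNReal.ofReal (δ / 2) * volume (closedBall (0 : F) (r / 2)))).trans hvol
    rw [Measure.addHaar_closedBall volume _ hρ0,
      Measure.addHaar_closedBall volume _ (by positivity : (0 : ℝ) ≤ r / 2),
      Measure.addHaar_closedBall volume _ (by positivity : (0 : ℝ) ≤ 2 * r)] at h2
    have hc0 : volume (ball (0 : F) 1) ≠ 0 := (measure_ball_pos _ _ one_pos).ne'
    have hct : volume (ball (0 : F) 1) ≠ ⊤ := measure_ball_lt_top.ne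
    set c := volume (ball (0 : F) 1)
    obtain ⟨c', hc', hcc⟩ : ∃ c' : ℝ, 0 < c' ∧ c = ENNReal.ofReal c' :=
      ⟨c.toReal, ENNReal.toReal_pos hc0 hct, (ENNReal.ofReal_toReal hct).symm⟩
    rw [hcc] at h2
    have hδ2 : 0 ≤ δ / 2 := by positivity
    rw [← ENNReal.ofReal_mul (by positivity), ← ENNReal.ofReal_mul (by positivity),
      ← ENNReal.ofReal_mul (by positivity), ← ENNReal.ofReal_mul (by positivity),
      ← ENNReal.ofReal_mul (by positivity), ← ENNReal.ofReal_mul (by positivity),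
      ENNReal.ofReal_le_ofReal_iff (by positivity)] at h2
    set m := finrank ℝ F
    have h3 : δ * ρ ^ m * ((r / 2) ^ m * c' ^ 2) ≤ 2 * (8 * r) ^ m * ((r / 2) ^ m * c' ^ 2) := by
      have e : (8 * r) ^ m * (r / 2) ^ m = (2 * r) ^ m * (2 * r) ^ m := by
        rw [← mul_pow, ← mul_pow]; congr 1; ring
      calc δ * ρ ^ m * ((r / 2) ^ m * c' ^ 2)
          = 2 * (δ / 2 * ((r / 2) ^ m * c') * (ρ ^ m * c')) := by ring
        _ ≤ 2 * ((2 * r) ^ m * c' * ((2 * r) ^ m * c')) := by gcongr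
        _ = 2 * ((2 * r) ^ m * (2 * r) ^ m) * c' ^ 2 := by ring
        _ = _ := by rw [← e]; ring
    have h4 : 0 < (r / 2) ^ m * c' ^ 2 := by positivity
    exact absurd (le_of_mul_le_mul_right h3 h4) (not_le.2 hρ)
  obtain ⟨f, b, hfb, hbw⟩ := geometric_hahn_banach_closed_point hQconv.closure isClosed_closure hwQ
  set t₀ : F := (InnerProductSpace.toDual ℝ F).symm f with ht₀
  have hft : ∀ x, f x = ⟪t₀, x⟫ := fun x => InnerProductSpace.toDual_symm_apply.symm
  have hb0 : 0 < b := by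
    have := hfb _ (hmem 0 h0D 0 h0D)
    simpa using this
  have ht₀n : 0 < ‖t₀‖ := by
    rw [norm_pos_iff]
    intro h0
    have := hbw
    rw [hft, h0, inner_zero_left] at this
    linarith
  have hwn : f w ≤ ‖t₀‖ * ρ := by
    rw [hft]
    rw [mem_closedBall, dist_zero_right] at hw
    exact (real_inner_le_norm _ _).trans (by gcongr)
  have key : ∀ x ∈ D, ∀ y ∈ D, ⟪t₀, x - y⟫ ≤ 2 * (‖t₀‖ * ρ) := fun x hx y hy => by
    have := hfb _ (hmem x hx y hy)
    rw [hft, inner_smul_right] at this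
    linarith
  refine ⟨‖t₀‖⁻¹ • t₀, by rw [norm_smul, norm_inv, norm_norm, inv_mul_cancel₀ ht₀n.ne'],
    fun x hx => ?_⟩
  rw [real_inner_smul_left, abs_mul, abs_of_pos (inv_pos.2 ht₀n), inv_mul_le_iff₀ ht₀n, abs_le]
  have h1 := key x hx 0 h0D
  have h2 := key 0 h0D x hx
  rw [sub_zero] at h1
  rw [zero_sub, inner_neg_right] at h2
  constructor <;> linarith

lemma LogConcaveOnClosed.volume_mul_measure_le (h : LogConcaveOnClosed ν) {r δ s L : ℝ}
    (hr : 0 < r) (hδ : 0 < δ) (hν : 1 / 2 ≤ ν.real (closedBall 0 r)) {t : F} (ht : ‖t‖ = 1)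
    (hL : ∀ x, δ ≤ ν.real (closedBall x (2 * r)) → |⟪t, x⟫| ≤ L) (hs : L + 2 * r < s) :
    volume (closedBall (0 : F) (2 * r)) * ν {z | s ≤ |⟪t, z⟫|} ≤
      ENNReal.ofReal (√(2 * δ)) * volume (closedBall (0 : F) (4 * r)) := by
  set B : Set F := {z | s ≤ |⟪t, z⟫|} with hB
  have hBm : MeasurableSet B := (isClosed_le continuous_const (by fun_prop)).measurableSet
  set S : Set (F × F) := {p | dist p.2 p.1 ≤ 2 * r} ∩ {p | p.2 ∈ B} with hS
  have hSm : MeasurableSet S :=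
    (isClosed_le (continuous_snd.dist continuous_fst) continuous_const).measurableSet.inter
      (measurable_snd hBm)
  have h1 := Measure.prod_apply (μ := (volume : Measure F)) (ν := ν) hSm
  have h2 := Measure.prod_apply_symm (μ := (volume : Measure F)) (ν := ν) hSm
  have h3 : ∀ y : F, volume ((fun x => (x, y)) ⁻¹' S) =
      B.indicator (fun _ => volume (closedBall (0 : F) (2 * r))) y := fun y => by
    by_cases hy : y ∈ B
    · rw [Set.indicator_of_mem hy, ← Measure.addHaar_closedBall_center volume y]
      congr 1
      ext x
      simp [hS, hy, dist_comm]
    · rw [Set.indicator_of_notMem hy]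
      convert measure_empty (μ := (volume : Measure F))
      ext x
      simp [hS, hy]
  simp_rw [h3] at h2
  rw [lintegral_indicator_const hBm] at h2
  rw [← h2, h1]
  have h5 : volume (closedBall (0 : F) (4 * r)) =
      ∫⁻ x, ν (closedBall ((1 / 2 : ℝ) • x) (2 * r)) := by
    rw [lintegral_measure_closedBall_smul (by norm_num)]
    congr 2; ring
  have hm4 : Measurable fun x : F => ν (closedBall ((1 / 2 : ℝ) • x) (2 * r)) :=
    (measurable_measure_closedBall (ν := ν) (2 * r)).comp (measurable_const_smul (1 / 2 : ℝ))
  rw [h5, ← lintegral_const_mul _ hm4]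
  refine lintegral_mono fun x => ?_
  by_cases hx : δ ≤ ν.real (closedBall x (2 * r))
  · refine le_trans (le_of_eq ?_) (zero_le)
    convert measure_empty (μ := ν)
    ext z
    simp only [hS, hB, Set.mem_preimage, Set.mem_inter_iff, Set.mem_ofPred_eq,
      Set.mem_empty_iff_false, iff_false, not_and, not_le]
    intro hz
    have e : ⟪t, z⟫ = ⟪t, x⟫ + ⟪t, z - x⟫ := by rw [← inner_add_right]; simp
    have h6 : |⟪t, z - x⟫| ≤ 2 * r := by
      refine (abs_real_inner_le_norm _ _).trans ?_
      rw [ht, one_mul, ← dist_eq_norm]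
      exact hz
    rw [e]
    linarith [abs_add_le ⟪t, x⟫ ⟪t, z - x⟫, hL x hx]
  · have h7 : ν (Prod.mk x ⁻¹' S) ≤ ν (closedBall x (2 * r)) := measure_mono fun z hz => hz.1
    refine h7.trans ?_
    rw [← ofReal_measureReal, ← ofReal_measureReal (μ := ν), ← ENNReal.ofReal_mul (sqrt_nonneg _)]
    refine ENNReal.ofReal_le_ofReal ?_
    have h8 := h.sqrt_mul_le_midpoint x 0 (2 * r)
    rw [add_zero] at h8
    set φ := ν.real (closedBall x (2 * r)) with hφ
    have hφ0 : 0 ≤ φ := measureReal_nonneg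
    have h9 : 1 / 2 ≤ ν.real (closedBall (0 : F) (2 * r)) :=
      hν.trans (measureReal_mono (closedBall_subset_closedBall (by linarith)))
    have h10 : √(φ * (1 / 2)) ≤ ν.real (closedBall ((1 / 2 : ℝ) • x) (2 * r)) :=
      (sqrt_le_sqrt (by gcongr)).trans h8
    calc φ = √(φ * φ) := (sqrt_mul_self hφ0).symm
      _ ≤ √((2 * δ) * (φ * (1 / 2))) := sqrt_le_sqrt (by nlinarith)
      _ = √(2 * δ) * √(φ * (1 / 2)) := sqrt_mul (by positivity) _
      _ ≤ _ := by gcongr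

/-- A log-concave probability measure giving mass at least `1/2` to a ball of radius `r` has a
one-dimensional marginal which is concentrated, up to exponentially small mass, on an interval of
length proportional to `r`. -/
lemma LogConcaveOnClosed.exists_direction_small_tail [Nontrivial F] (h : LogConcaveOnClosed ν)
    {r : ℝ} (hr : 0 < r) (hν : 1 / 2 ≤ ν.real (closedBall 0 r)) :
    ∃ t : F, ‖t‖ = 1 ∧ ν.real {z | 40 * exp 14 * r ≤ |⟪t, z⟫|} ≤
      exp (-(4 * finrank ℝ F)) / 2 := by
  set m := finrank ℝ F with hm
  have hm1 : 1 ≤ m := Module.finrank_pos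
  have hm1' : (1 : ℝ) ≤ m := by exact_mod_cast hm1
  set δ : ℝ := exp (-(14 * m)) with hδ
  have hδ0 : 0 < δ := exp_pos _
  have he1 : (2 : ℝ) ≤ exp 1 := by linarith [add_one_le_exp (1 : ℝ)]
  have he3 : (8 : ℝ) ≤ exp 3 := by
    have : exp 3 = exp 1 ^ 3 := by rw [← exp_nat_mul]; norm_num
    rw [this]
    calc (8 : ℝ) = 2 ^ 3 := by norm_num
      _ ≤ _ := by gcongr
  have hδ' : δ ≤ 1 / 2 := by
    rw [hδ, exp_neg, one_div]
    gcongr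
    exact he1.trans (exp_le_exp.2 (by linarith))
  have he14 : (1 : ℝ) ≤ exp 14 := one_le_exp (by norm_num)
  have hδm : δ * exp 14 ^ m = 1 := by
    rw [hδ, ← exp_nat_mul, ← exp_add, ← exp_zero]; congr 1; ring
  obtain ⟨t, ht, hD⟩ := h.exists_direction_bounding_superlevel hr hδ0 hδ' hν
    (ρ := 17 * exp 14 * r) (by positivity) (by
      calc 2 * (8 * r) ^ m ≤ 2 ^ m * (8 * r) ^ m := by
            gcongr
            exact le_self_pow₀ (by norm_num) (by omega)
        _ = (16 * r) ^ m := by rw [← mul_pow]; congr 1; ring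
        _ < (17 * r) ^ m := by
            refine pow_lt_pow_left₀ (by linarith) (by positivity) (by omega)
        _ = δ * exp 14 ^ m * (17 * r) ^ m := by rw [hδm, one_mul]
        _ = δ * (17 * exp 14 * r) ^ m := by rw [mul_assoc, ← mul_pow]; ring_nf)
  refine ⟨t, ht, ?_⟩
  have h1 := h.volume_mul_measure_le hr hδ0 hν ht hD (s := 40 * exp 14 * r) (by nlinarith)
  rw [Measure.addHaar_closedBall volume _ (by positivity : (0 : ℝ) ≤ 2 * r),
    Measure.addHaar_closedBall volume _ (by positivity : (0 : ℝ) ≤ 4 * r), ← hm] at h1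
  have hc0 : volume (ball (0 : F) 1) ≠ 0 := (measure_ball_pos _ _ one_pos).ne'
  have hct : volume (ball (0 : F) 1) ≠ ⊤ := measure_ball_lt_top.ne
  set c := volume (ball (0 : F) 1)
  obtain ⟨c', hc', hcc⟩ : ∃ c' : ℝ, 0 < c' ∧ c = ENNReal.ofReal c' :=
    ⟨c.toReal, ENNReal.toReal_pos hc0 hct, (ENNReal.ofReal_toReal hct).symm⟩
  rw [hcc, ← ofReal_measureReal (μ := ν), ← ENNReal.ofReal_mul (by positivity),
    ← ENNReal.ofReal_mul (by positivity), ← ENNReal.ofReal_mul (by positivity),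
    ← ENNReal.ofReal_mul (by positivity), ENNReal.ofReal_le_ofReal_iff (by positivity)] at h1
  set P := ν.real {z | 40 * exp 14 * r ≤ |⟪t, z⟫|}
  have h2 : P ≤ √(2 * δ) * 2 ^ m := by
    have h3 : ((2 * r) ^ m * c') * P ≤ ((2 * r) ^ m * c') * (√(2 * δ) * 2 ^ m) := by
      refine h1.trans (le_of_eq ?_)
      rw [show 4 * r = 2 * (2 * r) by ring, mul_pow 2 (2 * r)]; ring
    exact le_of_mul_le_mul_left h3 (by positivity)
  have h4 : √(2 * δ) ≤ 2 * exp (-(7 * m)) := by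
    rw [sqrt_le_left (by positivity)]
    have : exp (-(7 * (m : ℝ))) ^ 2 = δ := by rw [hδ, ← exp_nat_mul]; push_cast; congr 1; ring
    rw [mul_pow, this]; linarith
  have h5 : (2 : ℝ) ^ m * 4 ≤ exp (3 * m) := by
    calc (2 : ℝ) ^ m * 4 ≤ 2 ^ m * 4 ^ m := by
          gcongr
          exact le_self_pow₀ (by norm_num) (by omega)
      _ = 8 ^ m := by rw [← mul_pow]; norm_num
      _ ≤ exp 3 ^ m := by gcongr
      _ = exp (3 * m) := by rw [← exp_nat_mul]; congr 1; ring
  calc P ≤ √(2 * δ) * 2 ^ m := h2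
    _ ≤ 2 * exp (-(7 * m)) * 2 ^ m := by gcongr
    _ = exp (-(7 * m)) * (2 ^ m * 4) / 2 := by ring
    _ ≤ exp (-(7 * m)) * exp (3 * m) / 2 := by gcongr
    _ = _ := by rw [← exp_add]; congr 2; ring

end Slicing

section SphereNets

open Metric Module

lemma card_le_of_separated_sphere {F : Type*} [NormedAddCommGroup F] [NormedSpace ℝ F]
    [FiniteDimensional ℝ F] (s : Finset F) (hs : ∀ c ∈ s, ‖c‖ = 1)
    (h : ∀ c ∈ s, ∀ d ∈ s, c ≠ d → 1 / 8 ≤ ‖c - d‖) : s.card ≤ 17 ^ finrank ℝ F := by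
  borelize F
  let μ : Measure F := Measure.addHaar
  have D : Set.Pairwise (s : Set F) (Function.onFun Disjoint fun c => ball c (1 / 16 : ℝ)) := by
    rintro c hc d hd hcd
    apply ball_disjoint_ball
    rw [dist_eq_norm]
    linarith [h c hc d hd hcd]
  have hsub : (⋃ c ∈ s, ball c (1 / 16 : ℝ)) ⊆ ball (0 : F) (17 / 16) :=
    Set.iUnion₂_subset fun x hx => ball_subset_ball' (by rw [dist_zero_right, hs x hx]; norm_num)
  have h1 : μ (⋃ c ∈ s, ball c (1 / 16 : ℝ)) =
      s.card * ENNReal.ofReal ((1 / 16) ^ finrank ℝ F) * μ (ball 0 1) := by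
    rw [measure_biUnion_finset D fun c _ => measurableSet_ball]
    simp only [μ.addHaar_ball_of_pos _ (show (0 : ℝ) < 1 / 16 by norm_num), Finset.sum_const,
      nsmul_eq_mul, mul_assoc]
  have h2 := measure_mono (μ := μ) hsub
  rw [h1, μ.addHaar_ball_of_pos _ (show (0 : ℝ) < 17 / 16 by norm_num)] at h2
  have h3 := (ENNReal.mul_le_mul_iff_left (measure_ball_pos _ _ zero_lt_one).ne'
    measure_ball_lt_top.ne).1 h2
  have h4 := ENNReal.toReal_le_of_le_ofReal (by positivity) h3
  rw [ENNReal.toReal_mul, ENNReal.toReal_ofReal (by positivity), ENNReal.toReal_natCast,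
    show (17 / 16 : ℝ) = 17 * (1 / 16) by norm_num, mul_pow] at h4
  exact_mod_cast le_of_mul_le_mul_right h4 (by positivity)

lemma exists_sphere_net (F : Type*) [NormedAddCommGroup F] [NormedSpace ℝ F]
    [FiniteDimensional ℝ F] :
    ∃ s : Finset F, s.card ≤ 17 ^ finrank ℝ F ∧ (∀ c ∈ s, ‖c‖ = 1) ∧
      ∀ x : F, ‖x‖ = 1 → ∃ c ∈ s, ‖x - c‖ ≤ 1 / 8 := by
  classical
  let p : ℕ → Prop := fun k => ∃ s : Finset F, s.card = k ∧ (∀ c ∈ s, ‖c‖ = 1) ∧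
    ∀ c ∈ s, ∀ d ∈ s, c ≠ d → 1 / 8 ≤ ‖c - d‖
  have hp0 : p 0 := ⟨∅, by simp⟩
  have hle : ∀ k, p k → k ≤ 17 ^ finrank ℝ F := by
    rintro k ⟨s, rfl, h1, h2⟩
    exact card_le_of_separated_sphere s h1 h2
  obtain ⟨s, hsk, h1, h2⟩ := Nat.findGreatest_spec (P := p) (Nat.zero_le (17 ^ finrank ℝ F)) hp0
  refine ⟨s, card_le_of_separated_sphere s h1 h2, h1, fun x hx => ?_⟩
  by_contra! hcon
  have hxs : x ∉ s := fun hxs => by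
    have := hcon x hxs
    norm_num at this
  have hp : p (s.card + 1) := by
    refine ⟨insert x s, Finset.card_insert_of_notMem hxs, ?_, ?_⟩
    · intro c hc
      rcases Finset.mem_insert.1 hc with rfl | hc
      · exact hx
      · exact h1 c hc
    · intro c hc d hd hcd
      rcases Finset.mem_insert.1 hc with hc' | hc' <;>
        rcases Finset.mem_insert.1 hd with hd' | hd'
      · exact absurd (hc'.trans hd'.symm) hcd
      · rw [hc']; exact (hcon d hd').le
      · rw [hd', norm_sub_rev]; exact (hcon c hc').le
      · exact h2 c hc' d hd' hcd
  have := Nat.le_findGreatest (hle _ hp) hp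
  omega

lemma Seminorm.le_on_sphere_of_net {F : Type*} [NormedAddCommGroup F] [NormedSpace ℝ F]
    [FiniteDimensional ℝ F] (N : Seminorm ℝ F) (hN : Continuous N) {s : Finset F}
    (hs : ∀ x : F, ‖x‖ = 1 → ∃ c ∈ s, ‖x - c‖ ≤ 1 / 8) {M : ℝ}
    (hlow : ∀ c ∈ s, M / 2 ≤ N c) (hup : ∀ c ∈ s, N c ≤ 2 * M) {x : F} (hx : ‖x‖ = 1) :
    3 * M / 14 ≤ N x := by
  obtain ⟨x₀, hx₀, hmax⟩ := (isCompact_sphere (0 : F) 1).exists_isMaxOn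
    ⟨x, by simpa using hx⟩ hN.continuousOn
  rw [mem_sphere_zero_iff_norm] at hx₀
  have hB : ∀ y, N y ≤ ‖y‖ * N x₀ := fun y => by
    rcases eq_or_ne y 0 with rfl | hy
    · simp
    have hy' : 0 < ‖y‖ := norm_pos_iff.2 hy
    have h1 : N (‖y‖⁻¹ • y) ≤ N x₀ := hmax (by
      rw [mem_sphere_zero_iff_norm, norm_smul, norm_inv, norm_norm, inv_mul_cancel₀ hy'.ne'])
    rwa [map_smul_eq_mul, norm_inv, norm_norm, inv_mul_le_iff₀ hy'] at h1
  have h0 : 0 ≤ N x₀ := apply_nonneg N x₀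
  obtain ⟨c₀, hc₀, hd₀⟩ := hs x₀ hx₀
  obtain ⟨c, hc, hd⟩ := hs x hx
  have h1 : N x₀ ≤ N c₀ + N (x₀ - c₀) := by simpa using map_add_le_add N c₀ (x₀ - c₀)
  have h2 : N c ≤ N x + N (x - c) := by
    have := map_add_le_add N x (c - x)
    rwa [add_sub_cancel, map_sub_rev] at this
  have h3 : N (x₀ - c₀) ≤ 1 / 8 * N x₀ := (hB _).trans (by gcongr)
  have h4 : N (x - c) ≤ 1 / 8 * N x₀ := (hB _).trans (by gcongr)
  linarith [hup c₀ hc₀, hlow c hc]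

end SphereNets

section GaussianMatrices

open Module

variable {E : Type*} [NormedAddCommGroup E] [InnerProductSpace ℝ E] [FiniteDimensional ℝ E]
  [MeasurableSpace E] [BorelSpace E] {m : ℕ}

lemma pi_stdGaussian_map_sum {t : EuclideanSpace ℝ (Fin m)} (ht : ‖t‖ = 1) :
    (Measure.pi fun _ : Fin m => stdGaussian E).map (fun g => ∑ j, t j • g j) =
      stdGaussian E := by
  have hm : Measurable fun g : Fin m → E => ∑ j, t j • g j := by fun_prop
  have : IsProbabilityMeasure ((Measure.pi fun _ : Fin m => stdGaussian E).map
      (fun g => ∑ j, t j • g j)) := Measure.isProbabilityMeasure_map hm.aemeasurable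
  refine Measure.ext_of_charFun ?_
  ext x
  rw [charFun_stdGaussian, charFun_apply, integral_map hm.aemeasurable (by fun_prop)]
  have h1 : ∀ g : Fin m → E, Complex.exp (((⟪∑ j, t j • g j, x⟫ : ℝ) : ℂ) * Complex.I) =
      ∏ j, Complex.exp (((⟪g j, t j • x⟫ : ℝ) : ℂ) * Complex.I) := fun g => by
    rw [← Complex.exp_sum, sum_inner, Complex.ofReal_sum, Finset.sum_mul]
    congr 1
    refine Finset.sum_congr rfl fun j _ => ?_
    rw [real_inner_smul_left, real_inner_smul_right]
  simp_rw [h1]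
  rw [integral_fintype_prod_eq_prod (μ := fun _ : Fin m => stdGaussian E)
    (f := fun j (y : E) => Complex.exp (((⟪y, t j • x⟫ : ℝ) : ℂ) * Complex.I))]
  have h2 : ∀ j, ∫ y, Complex.exp (((⟪y, t j • x⟫ : ℝ) : ℂ) * Complex.I) ∂(stdGaussian E) =
      Complex.exp (-((‖t j • x‖ : ℝ) : ℂ) ^ 2 / 2) := fun j => by
    rw [← charFun_apply, charFun_stdGaussian]
  simp_rw [h2]
  rw [← Complex.exp_sum]
  congr 1
  have h3 : ∑ j, t j ^ 2 = 1 := by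
    rw [← one_pow 2, ← ht, EuclideanSpace.norm_sq_eq]
    simp
  have h4 : ∑ j, ‖t j • x‖ ^ 2 = ‖x‖ ^ 2 := by
    simp_rw [norm_smul, mul_pow, Real.norm_eq_abs, sq_abs]
    rw [← Finset.sum_mul, h3, one_mul]
  rw [← Finset.sum_div, Finset.sum_neg_distrib]
  congr 2
  exact_mod_cast h4

/-- The operator `y ↦ (⟨g₁, y⟩, …, ⟨gₘ, y⟩)`. -/
def innerOperator (g : Fin m → E) : E →L[ℝ] EuclideanSpace ℝ (Fin m) :=
  ((EuclideanSpace.equiv (Fin m) ℝ).symm : (Fin m → ℝ) →L[ℝ] EuclideanSpace ℝ (Fin m)) ∘L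
    ContinuousLinearMap.pi fun j => innerSL ℝ (g j)

omit [FiniteDimensional ℝ E] [MeasurableSpace E] [BorelSpace E] in
lemma innerOperator_apply (g : Fin m → E) (y : E) (j : Fin m) :
    innerOperator g y j = ⟪g j, y⟫ := rfl

omit [MeasurableSpace E] [BorelSpace E] in
lemma adjoint_innerOperator_apply (g : Fin m → E) (t : EuclideanSpace ℝ (Fin m)) :
    ContinuousLinearMap.adjoint (innerOperator g) t = ∑ j, t j • g j := by
  refine ext_inner_right ℝ fun y => ?_
  rw [ContinuousLinearMap.adjoint_inner_left, sum_inner, PiLp.inner_apply]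
  refine Finset.sum_congr rfl fun j _ => ?_
  rw [innerOperator_apply, real_inner_smul_left]
  simp [mul_comm]

lemma lintegral_inner_sq_stdGaussian (y : E) :
    ∫⁻ x, ENNReal.ofReal (⟪x, y⟫ ^ 2) ∂(stdGaussian E) = ENNReal.ofReal (‖y‖ ^ 2) := by
  have h1 := variance_dual_stdGaussian (innerSL ℝ y)
  have hmem : MemLp (innerSL ℝ y) 2 (stdGaussian E) :=
    IsGaussian.memLp_dual _ _ _ (by simp)
  rw [variance_eq_sub hmem, integral_strongDual_stdGaussian] at h1
  rw [← ofReal_integral_eq_lintegral_ofReal ?_ (ae_of_all _ fun x => sq_nonneg _)]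
  · congr 1
    simp only [innerSL_apply_norm] at h1
    rw [← h1]
    simp [real_inner_comm]
  · simpa [real_inner_comm] using hmem.integrable_sq

lemma lintegral_innerOperator_sq (y : E) :
    ∫⁻ g, ENNReal.ofReal (‖innerOperator g y‖ ^ 2) ∂(Measure.pi fun _ : Fin m => stdGaussian E) =
      m * ENNReal.ofReal (‖y‖ ^ 2) := by
  have h1 : ∀ g : Fin m → E, ENNReal.ofReal (‖innerOperator g y‖ ^ 2) =
      ∑ j, ENNReal.ofReal (⟪g j, y⟫ ^ 2) := fun g => by
    rw [EuclideanSpace.norm_sq_eq, ENNReal.ofReal_sum_of_nonneg fun _ _ => by positivity]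
    simp [innerOperator_apply]
  simp_rw [h1]
  rw [lintegral_finsetSum _ fun j _ => by fun_prop]
  have h2 : ∀ j : Fin m, ∫⁻ g, ENNReal.ofReal (⟪g j, y⟫ ^ 2)
      ∂(Measure.pi fun _ : Fin m => stdGaussian E) = ENNReal.ofReal (‖y‖ ^ 2) := fun j => by
    have hmp := measurePreserving_eval (fun _ : Fin m => stdGaussian E) j
    rw [← lintegral_inner_sq_stdGaussian y, ← hmp.lintegral_comp (by fun_prop)]
  simp [h2]

end GaussianMatrices

section GaussianMean

open Module Metric

variable {E : Type*} [NormedAddCommGroup E] [InnerProductSpace ℝ E] [FiniteDimensional ℝ E]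
  [MeasurableSpace E] [BorelSpace E]

lemma four_mul_seventeen_pow_mul_exp_lt {m : ℕ} (hm : 1 ≤ m) :
    (17 : ℝ) ^ m * (4 * exp (-(20 * m))) < 3 / 4 := by
  have h1 : (17 : ℝ) * exp (-20) ≤ 1 / 16 := by
    have h3 : (2 : ℝ) ^ 20 ≤ exp 20 := by
      have := pow_le_pow_left₀ (by norm_num) (show (2 : ℝ) ≤ exp 1 by
        linarith [add_one_le_exp (1 : ℝ)]) 20
      rwa [← exp_nat_mul, show ((20 : ℕ) : ℝ) * 1 = 20 by norm_num] at this
    rw [exp_neg, ← div_eq_mul_inv, div_le_iff₀ (exp_pos _)]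
    norm_num at h3
    linarith
  have h2 : exp (-(20 * (m : ℝ))) = exp (-20) ^ m := by
    rw [← exp_nat_mul]; ring_nf
  calc (17 : ℝ) ^ m * (4 * exp (-(20 * m))) = 4 * (17 * exp (-20)) ^ m := by
        rw [h2, mul_pow]; ring
    _ ≤ 4 * (1 / 16) ^ m := by gcongr
    _ ≤ 4 * (1 / 16) ^ 1 := by
        gcongr 4 * ?_
        exact pow_le_pow_of_le_one (by norm_num) (by norm_num) hm
    _ < 3 / 4 := by norm_num

lemma lintegral_lintegral_innerOperator_sq_le {m : ℕ} {ν : Measure E} [IsProbabilityMeasure ν]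
    {k : ℝ} (hνk : ∫⁻ y, ENNReal.ofReal (‖y‖ ^ 2) ∂ν ≤ ENNReal.ofReal k) :
    ∫⁻ g, ∫⁻ y, ENNReal.ofReal (‖innerOperator g y‖ ^ 2) ∂ν
      ∂(Measure.pi fun _ : Fin m => stdGaussian E) ≤ m * ENNReal.ofReal k := by
  have hms : Measurable fun p : (Fin m → E) × E =>
      ENNReal.ofReal (‖innerOperator p.1 p.2‖ ^ 2) := by
    simp_rw [EuclideanSpace.norm_sq_eq, innerOperator_apply]
    fun_prop
  rw [lintegral_lintegral_swap hms.aemeasurable]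
  simp_rw [lintegral_innerOperator_sq]
  rw [lintegral_const_mul _ (by fun_prop)]
  gcongr

lemma exists_gaussian_matrix (ν : Measure E) [IsProbabilityMeasure ν] {k : ℝ} (hk : 0 < k)
    (hνk : ∫⁻ y, ENNReal.ofReal (‖y‖ ^ 2) ∂ν ≤ ENNReal.ofReal k) (N : Seminorm ℝ E) {σ : ℝ}
    (hσ : 0 < σ) (hN : ∀ x, N x ≤ σ * ‖x‖) {m : ℕ} (hm : 1 ≤ m)
    (hM : 400 * m * σ ^ 2 ≤ (∫ y, N y ∂(stdGaussian E)) ^ 2) :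
    ∃ g : Fin m → E,
      ∫⁻ y, ENNReal.ofReal (‖innerOperator g y‖ ^ 2) ∂ν ≤ ENNReal.ofReal (4 * (m * k)) ∧
      ∀ t, ‖t‖ = 1 → 3 * (∫ y, N y ∂(stdGaussian E)) / 14 ≤
        N (ContinuousLinearMap.adjoint (innerOperator g) t) := by
  set M := ∫ y, N y ∂(stdGaussian E) with hMdef
  have hcont : Continuous N := (Seminorm.lipschitzWith_of_bound N hσ.le hN).continuous
  obtain ⟨s, hcard, hs1, hs⟩ := exists_sphere_net (EuclideanSpace ℝ (Fin m))
  rw [finrank_euclideanSpace_fin] at hcard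
  set P := Measure.pi fun _ : Fin m => stdGaussian E with hP
  let B : Set (Fin m → E) := {g | ENNReal.ofReal (4 * (m * k)) ≤
    ∫⁻ y, ENNReal.ofReal (‖innerOperator g y‖ ^ 2) ∂ν}
  let A : EuclideanSpace ℝ (Fin m) → Set (Fin m → E) := fun c =>
    {g | N (∑ j, c j • g j) ≤ M / 2} ∪ {g | 2 * M ≤ N (∑ j, c j • g j)}
  have hmk : 0 < (m : ℝ) * k := by positivity
  have hB : P B ≤ ENNReal.ofReal (1 / 4) := by
    have h1 : ENNReal.ofReal (4 * (m * k)) * P B ≤ ENNReal.ofReal (4 * (m * k)) *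
        ENNReal.ofReal (1 / 4) := by
      refine (mul_meas_ge_le_lintegral₀ ?_ _).trans
        ((lintegral_lintegral_innerOperator_sq_le hνk).trans ?_)
      · refine Measurable.aemeasurable (Measurable.lintegral_prod_right' (f := fun p :
          (Fin m → E) × E => ENNReal.ofReal (‖innerOperator p.1 p.2‖ ^ 2)) ?_)
        simp_rw [EuclideanSpace.norm_sq_eq, innerOperator_apply]
        fun_prop
      · rw [← ENNReal.ofReal_mul (by positivity), ← ENNReal.ofReal_natCast,
          ← ENNReal.ofReal_mul (by positivity)]
        refine ENNReal.ofReal_le_ofReal ?_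
        linarith
    exact (ENNReal.mul_le_mul_iff_right (ENNReal.ofReal_pos.2 (by positivity)).ne'
      ENNReal.ofReal_ne_top).1 h1
  have hA : ∀ c ∈ s, P (A c) ≤ ENNReal.ofReal (4 * exp (-(20 * m))) := fun c hc => by
    have hmeas : Measurable fun g : Fin m → E => ∑ j, c j • g j := by fun_prop
    have hmap := pi_stdGaussian_map_sum (E := E) (hs1 c hc)
    have h1 := stdGaussian_seminorm_le_half_integral N hσ hN hM
    have h2 := stdGaussian_two_mul_integral_le_seminorm N hσ hN hM
    rw [← hMdef, ← hmap, Measure.map_apply hmeas (measurableSet_le (by fun_prop) (by fun_prop))]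
      at h1 h2
    refine (measure_union_le _ _).trans ((add_le_add h1 h2).trans ?_)
    rw [← ENNReal.ofReal_add (by positivity) (by positivity)]
    exact ENNReal.ofReal_le_ofReal (by linarith)
  have hlt : P (B ∪ ⋃ c ∈ s, A c) < 1 := by
    calc P (B ∪ ⋃ c ∈ s, A c) ≤ P B + ∑ c ∈ s, P (A c) :=
          (measure_union_le _ _).trans (by gcongr; exact measure_biUnion_finset_le _ _)
      _ ≤ ENNReal.ofReal (1 / 4) + ∑ _c ∈ s, ENNReal.ofReal (4 * exp (-(20 * m))) := by
          gcongr with c hc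
          exact hA c hc
      _ = ENNReal.ofReal (1 / 4 + s.card * (4 * exp (-(20 * m)))) := by
          rw [Finset.sum_const, nsmul_eq_mul, ENNReal.ofReal_add (by norm_num) (by positivity),
            ENNReal.ofReal_mul (Nat.cast_nonneg _), ENNReal.ofReal_natCast]
      _ < 1 := by
          rw [ENNReal.ofReal_lt_one]
          have h1 : (s.card : ℝ) ≤ 17 ^ m := by exact_mod_cast hcard
          have h2 : (s.card : ℝ) * (4 * exp (-(20 * m))) ≤ 17 ^ m * (4 * exp (-(20 * m))) := by
            gcongr
          linarith [four_mul_seventeen_pow_mul_exp_lt hm]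
  obtain ⟨g, hg⟩ : ∃ g, g ∉ B ∪ ⋃ c ∈ s, A c := by
    by_contra! hcon
    rw [Set.eq_univ_of_forall hcon, measure_univ] at hlt
    exact lt_irrefl _ hlt
  simp only [Set.mem_union, Set.mem_iUnion, not_or, not_exists, B, A, Set.mem_ofPred_eq,
    not_le] at hg
  refine ⟨g, hg.1.le, fun t ht => ?_⟩
  refine Seminorm.le_on_sphere_of_net
    (N.comp (ContinuousLinearMap.adjoint (innerOperator g)).toLinearMap) ?_ hs
    (fun c hc => ?_) (fun c hc => ?_) ht
  · exact hcont.comp (ContinuousLinearMap.adjoint (innerOperator g)).continuous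
  · have := (hg.2 c hc).1.le
    rw [← adjoint_innerOperator_apply] at this
    exact this
  · have := (hg.2 c hc).2.le
    rw [← adjoint_innerOperator_apply] at this
    exact this

lemma LogConcaveOnClosed.exists_seminorm_adjoint_le {F : Type*} [NormedAddCommGroup F]
    [InnerProductSpace ℝ F] [FiniteDimensional ℝ F] [MeasurableSpace F] [BorelSpace F]
    [Nontrivial F] {ν : Measure E} [IsProbabilityMeasure ν] (h : LogConcaveOnClosed ν)
    (T : E →L[ℝ] F) {v : ℝ} (hv : 0 < v)
    (hT : ∫⁻ y, ENNReal.ofReal (‖T y‖ ^ 2) ∂ν ≤ ENNReal.ofReal v) (N : Seminorm ℝ E)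
    (hN : ∀ x, ENNReal.ofReal (N x ^ finrank ℝ F) =
      ∫⁻ y, ENNReal.ofReal (|⟪x, y⟫| ^ finrank ℝ F) ∂ν) :
    ∃ t, ‖t‖ = 1 ∧ N (ContinuousLinearMap.adjoint T t) ≤ 3 * (40 * exp 14 * √(2 * v)) := by
  have hTm : Measurable T := T.continuous.measurable
  have : IsProbabilityMeasure (ν.map T) := Measure.isProbabilityMeasure_map hTm.aemeasurable
  have hr : 0 < √(2 * v) := by positivity
  have hball : 1 / 2 ≤ (ν.map T).real (closedBall 0 (√(2 * v))) := by
    have h1 : ν {y | ENNReal.ofReal (2 * v) ≤ ENNReal.ofReal (‖T y‖ ^ 2)} ≤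
        ENNReal.ofReal (1 / 2) := by
      have h2 : ENNReal.ofReal (2 * v) *
          ν {y | ENNReal.ofReal (2 * v) ≤ ENNReal.ofReal (‖T y‖ ^ 2)} ≤
          ENNReal.ofReal (2 * v) * ENNReal.ofReal (1 / 2) := by
        refine (mul_meas_ge_le_lintegral₀ (by fun_prop) _).trans (hT.trans ?_)
        rw [← ENNReal.ofReal_mul (by positivity)]
        exact ENNReal.ofReal_le_ofReal (by linarith)
      exact (ENNReal.mul_le_mul_iff_right (by simpa using hv) ENNReal.ofReal_ne_top).1 h2
    have h2 : (ν.map T) (closedBall 0 (√(2 * v)))ᶜ ≤ ENNReal.ofReal (1 / 2) := by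
      rw [Measure.map_apply hTm measurableSet_closedBall.compl]
      refine (measure_mono fun y hy => ?_).trans h1
      simp only [Set.mem_preimage, Set.mem_compl_iff, mem_closedBall, dist_zero_right,
        not_le] at hy
      exact ENNReal.ofReal_le_ofReal (Real.lt_sq_of_sqrt_lt hy).le
    have h3 := ENNReal.toReal_le_of_le_ofReal (by norm_num) h2
    have h4 := probReal_compl_eq_one_sub (μ := ν.map T)
      (measurableSet_closedBall (x := (0 : F)) (ε := √(2 * v)))
    rw [measureReal_def] at h4
    linarith
  obtain ⟨t, ht, htail⟩ := (h.map T).exists_direction_small_tail hr hball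
  refine ⟨t, ht, ?_⟩
  set s := 40 * exp 14 * √(2 * v)
  have hs : 0 < s := by positivity
  set x := ContinuousLinearMap.adjoint T t
  have hxm : Measurable (innerSL ℝ x) := (innerSL ℝ x).continuous.measurable
  have : IsProbabilityMeasure (ν.map (innerSL ℝ x)) :=
    Measure.isProbabilityMeasure_map hxm.aemeasurable
  have hq : 1 ≤ finrank ℝ F := finrank_pos
  have hx : ∀ y, ⟪x, y⟫ = ⟪t, T y⟫ := fun y => ContinuousLinearMap.adjoint_inner_left T y t
  have h5 := (h.map (innerSL ℝ x)).lintegral_abs_pow_le hs hq (by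
    rw [measureReal_def, Measure.map_apply hxm (measurableSet_le (by fun_prop) (by fun_prop))]
    rw [measureReal_def, Measure.map_apply hTm (measurableSet_le (by fun_prop) (by fun_prop))]
      at htail
    simpa [hx] using htail)
  rw [lintegral_map (by fun_prop) hxm] at h5
  simp only [innerSL_apply_apply] at h5
  rw [← hN] at h5
  have h6 := (ENNReal.ofReal_le_ofReal_iff (by positivity)).1 h5
  refine le_of_pow_le_pow_left₀ (n := finrank ℝ F) (by omega) (by positivity) (h6.trans ?_)
  rw [mul_pow 3 s]
  exact mul_le_mul_of_nonneg_right (le_self_pow₀ (by norm_num) (by omega)) (by positivity)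

lemma LogConcaveOnClosed.integral_seminorm_stdGaussian_le {ν : Measure E}
    [IsProbabilityMeasure ν] (h : LogConcaveOnClosed ν) {k : ℝ} (hk : 0 < k)
    (hνk : ∫⁻ y, ENNReal.ofReal (‖y‖ ^ 2) ∂ν ≤ ENNReal.ofReal k) (N : Seminorm ℝ E) {σ : ℝ}
    (hσ : 0 < σ) (hN : ∀ x, N x ≤ σ * ‖x‖) {m : ℕ} (hm : 1 ≤ m)
    (hNm : ∀ x, ENNReal.ofReal (N x ^ m) = ∫⁻ y, ENNReal.ofReal (|⟪x, y⟫| ^ m) ∂ν) :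
    ∫ y, N y ∂(stdGaussian E) ≤ √m * (20 * σ + 1600 * exp 14 * √k) := by
  set M := ∫ y, N y ∂(stdGaussian E) with hMdef
  have hM0 : 0 ≤ M := integral_nonneg fun y => apply_nonneg N y
  by_cases hM : 400 * m * σ ^ 2 ≤ M ^ 2
  · obtain ⟨g, hg1, hg2⟩ := exists_gaussian_matrix ν hk hνk N hσ hN hm hM
    have : Nontrivial (EuclideanSpace ℝ (Fin m)) :=
      Module.nontrivial_of_finrank_pos (R := ℝ) (by rw [finrank_euclideanSpace_fin]; omega)
    obtain ⟨t, ht, htN⟩ := h.exists_seminorm_adjoint_le (innerOperator g) (by positivity) hg1 N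
      (by simpa [finrank_euclideanSpace_fin] using hNm)
    have h1 := (hg2 t ht).trans htN
    have h2 : √(2 * (4 * (m * k))) ≤ 20 / 7 * (√m * √k) := by
      rw [← Real.sqrt_mul (Nat.cast_nonneg m)]
      refine Real.sqrt_le_iff.2 ⟨by positivity, ?_⟩
      rw [mul_pow, Real.sq_sqrt (by positivity)]
      nlinarith [show 0 < (m : ℝ) * k by positivity]
    have h3 : 3 * M / 14 ≤ 3 * (40 * exp 14 * (20 / 7 * (√m * √k))) := h1.trans (by gcongr)
    have h4 : 0 ≤ √m * (20 * σ) := by positivity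
    linarith
  · have h1 : M ≤ √m * (20 * σ) := by
      refine le_of_pow_le_pow_left₀ two_ne_zero (by positivity) ?_
      rw [mul_pow, Real.sq_sqrt (Nat.cast_nonneg m)]
      linarith
    have h2 : 0 ≤ √m * (1600 * exp 14 * √k) := by positivity
    linarith

end GaussianMean

section NormMoments

variable {E : Type*} [NormedAddCommGroup E] [InnerProductSpace ℝ E] [FiniteDimensional ℝ E]
  [MeasurableSpace E] [BorelSpace E]

lemma le_lintegral_abs_pow_gaussianReal {m : ℕ} (hm : 1 ≤ m) :
    ENNReal.ofReal (√m ^ m * exp (-(2 * m)) / 3) ≤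
      ∫⁻ x, ENNReal.ofReal (|x| ^ m) ∂(gaussianReal 0 1) := by
  have hm1 : 1 ≤ √(m : ℝ) := Real.one_le_sqrt.2 (by exact_mod_cast hm)
  rw [gaussianReal_of_var_ne_zero _ one_ne_zero,
    lintegral_withDensity_eq_lintegral_mul _ (measurable_gaussianPDF 0 1) (by fun_prop)]
  have h2 : ∀ x ∈ Set.Icc (√(m : ℝ)) (2 * √m), ENNReal.ofReal (√m ^ m * exp (-(2 * m)) / 3) ≤
      (gaussianPDF 0 1 * fun x => ENNReal.ofReal (|x| ^ m)) x := fun x hx => by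
    have hx0 : 0 ≤ x := (Real.sqrt_nonneg _).trans hx.1
    rw [Pi.mul_apply, gaussianPDF_def, ← ENNReal.ofReal_mul (gaussianPDFReal_nonneg _ _ _)]
    refine ENNReal.ofReal_le_ofReal ?_
    rw [gaussianPDFReal_def, abs_of_nonneg hx0]
    have h3 : (1 : ℝ) / 3 ≤ (√(2 * π * ((1 : NNReal) : ℝ)))⁻¹ := by
      rw [one_div]
      refine inv_anti₀ (by positivity) (Real.sqrt_le_iff.2 ⟨by norm_num, ?_⟩)
      have := Real.pi_lt_d2
      push_cast
      linarith
    have h4 : exp (-(2 * m)) ≤ exp (-(x - 0) ^ 2 / (2 * ((1 : NNReal) : ℝ))) := by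
      refine exp_le_exp.2 ?_
      have h5 : x ^ 2 ≤ (2 * √(m : ℝ)) ^ 2 := pow_le_pow_left₀ hx0 hx.2 2
      rw [mul_pow, Real.sq_sqrt (Nat.cast_nonneg m)] at h5
      push_cast
      linarith
    calc √m ^ m * exp (-(2 * m)) / 3 = 1 / 3 * exp (-(2 * m)) * √m ^ m := by ring
      _ ≤ _ := mul_le_mul (mul_le_mul h3 h4 (exp_pos _).le (by positivity))
        (pow_le_pow_left₀ (Real.sqrt_nonneg _) hx.1 m) (by positivity) (by positivity)
  calc ENNReal.ofReal (√m ^ m * exp (-(2 * m)) / 3)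
      ≤ ENNReal.ofReal (√m ^ m * exp (-(2 * m)) / 3) *
          volume (Set.Icc (√(m : ℝ)) (2 * √m)) := by
        rw [Real.volume_Icc]
        refine le_mul_of_one_le_right' ?_
        rw [← ENNReal.ofReal_one]
        exact ENNReal.ofReal_le_ofReal (by linarith)
    _ = ∫⁻ _ in Set.Icc (√(m : ℝ)) (2 * √m), ENNReal.ofReal (√m ^ m * exp (-(2 * m)) / 3) := by
        rw [setLIntegral_const]
    _ ≤ ∫⁻ x in Set.Icc (√(m : ℝ)) (2 * √m),
          (gaussianPDF 0 1 * fun x => ENNReal.ofReal (|x| ^ m)) x :=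
        setLIntegral_mono' measurableSet_Icc h2
    _ ≤ _ := setLIntegral_le_lintegral _ _

lemma lintegral_abs_inner_pow_stdGaussian (y : E) (m : ℕ) :
    ∫⁻ x, ENNReal.ofReal (|⟪x, y⟫| ^ m) ∂(stdGaussian E) =
      ENNReal.ofReal (‖y‖ ^ m) * ∫⁻ z, ENNReal.ofReal (|z| ^ m) ∂(gaussianReal 0 1) := by
  have h1 : (stdGaussian E).map (innerSL ℝ y) = (gaussianReal 0 1).map (‖y‖ * ·) := by
    rw [stdGaussian_map_strongDual, gaussianReal_map_const_mul, innerSL_apply_norm]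
    congr 1
    · simp
    · ext
      simp
  have h2 : ∫⁻ x, ENNReal.ofReal (|⟪x, y⟫| ^ m) ∂(stdGaussian E) =
      ∫⁻ z, ENNReal.ofReal (|z| ^ m) ∂((stdGaussian E).map (innerSL ℝ y)) := by
    rw [lintegral_map (by fun_prop) (innerSL ℝ y).continuous.measurable]
    simp [real_inner_comm]
  rw [h2, h1, lintegral_map (by fun_prop) (by fun_prop), ← lintegral_const_mul _ (by fun_prop)]
  refine lintegral_congr fun z => ?_
  rw [abs_mul, abs_norm, mul_pow, ENNReal.ofReal_mul (by positivity)]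

lemma eLpNorm_natCast_pow {α : Type*} [MeasurableSpace α] (ν : Measure α) (f : α → ℝ) {m : ℕ}
    (hm : m ≠ 0) : eLpNorm f m ν ^ m = ∫⁻ y, ENNReal.ofReal (|f y| ^ m) ∂ν := by
  rw [eLpNorm_eq_lintegral_rpow_enorm_toReal (by exact_mod_cast hm) (ENNReal.natCast_ne_top m)]
  simp only [ENNReal.toReal_natCast, ENNReal.rpow_natCast]
  rw [← ENNReal.rpow_natCast, ← ENNReal.rpow_mul, one_div_mul_cancel (by exact_mod_cast hm),
    ENNReal.rpow_one]
  refine lintegral_congr fun y => ?_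
  rw [← ofReal_norm, Real.norm_eq_abs, ENNReal.ofReal_pow (abs_nonneg _)]

lemma exists_seminorm_pow_eq_lintegral {ν : Measure E} {m : ℕ} (hm : 1 ≤ m)
    (hfin : ∀ x, ∫⁻ y, ENNReal.ofReal (|⟪x, y⟫| ^ m) ∂ν < ⊤) :
    ∃ N : Seminorm ℝ E,
      ∀ x, ENNReal.ofReal (N x ^ m) = ∫⁻ y, ENNReal.ofReal (|⟪x, y⟫| ^ m) ∂ν := by
  have h2 : ∀ x : E, eLpNorm (fun y => ⟪x, y⟫) m ν ≠ ⊤ := fun x => by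
    have h1 := (hfin x).ne
    rw [← eLpNorm_natCast_pow ν _ (by omega)] at h1
    intro h3
    rw [h3, ENNReal.top_pow (by omega)] at h1
    exact h1 rfl
  refine ⟨Seminorm.of (fun x => (eLpNorm (fun y => ⟪x, y⟫) m ν).toReal) (fun x x' => ?_)
    (fun a x => ?_), fun x => ?_⟩
  · rw [← ENNReal.toReal_add (h2 x) (h2 x')]
    refine ENNReal.toReal_mono (ENNReal.add_ne_top.2 ⟨h2 x, h2 x'⟩) ?_
    simp_rw [inner_add_left]
    exact eLpNorm_add_le (by fun_prop) (by fun_prop) (by exact_mod_cast hm)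
  · simp_rw [real_inner_smul_left]
    have := eLpNorm_const_smul (p := (m : ℝ≥0∞)) (μ := ν) a (fun y => ⟪x, y⟫)
    change (eLpNorm (a • fun y => ⟪x, y⟫) m ν).toReal = _
    rw [this, ENNReal.toReal_mul, toReal_enorm]
  · change ENNReal.ofReal ((eLpNorm (fun y => ⟪x, y⟫) m ν).toReal ^ m) = _
    rw [ENNReal.ofReal_pow ENNReal.toReal_nonneg, ENNReal.ofReal_toReal (h2 x),
      eLpNorm_natCast_pow ν _ (by omega)]

/-- Comparison of the strong and weak `m`-th moments of a log-concave measure. -/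
theorem LogConcaveOnClosed.lintegral_norm_pow_le {ν : Measure E}
    [IsProbabilityMeasure ν] (h : LogConcaveOnClosed ν) {k : ℝ} (hk : 0 < k)
    (hνk : ∫⁻ y, ENNReal.ofReal (‖y‖ ^ 2) ∂ν ≤ ENNReal.ofReal k) {σ : ℝ} (hσ : 0 < σ) {m : ℕ}
    (hm : 1 ≤ m)
    (hνσ : ∀ x, ∫⁻ y, ENNReal.ofReal (|⟪x, y⟫| ^ m) ∂ν ≤ ENNReal.ofReal ((σ * ‖x‖) ^ m)) :
    ∫⁻ y, ENNReal.ofReal (‖y‖ ^ m) ∂ν ≤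
      ENNReal.ofReal ((6 * exp 4 * (20 * σ + 1600 * exp 14 * √k)) ^ m) := by
  obtain ⟨N, hN⟩ := exists_seminorm_pow_eq_lintegral hm
    fun x => (hνσ x).trans_lt ENNReal.ofReal_lt_top
  have hNσ : ∀ x, N x ≤ σ * ‖x‖ := fun x => by
    have h1 := (hN x).trans_le (hνσ x)
    exact le_of_pow_le_pow_left₀ (by omega) (by positivity)
      ((ENNReal.ofReal_le_ofReal_iff (by positivity)).1 h1)
  set D := 20 * σ + 1600 * exp 14 * √k with hD
  have hD0 : 0 < D := by positivity
  have hm0 : 0 < √(m : ℝ) := Real.sqrt_pos.2 (by exact_mod_cast hm)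
  have hσM : 400 * m * σ ^ 2 ≤ (√m * D) ^ 2 := by
    have h1 : 20 * σ ≤ D := by rw [hD]; linarith [show 0 ≤ 1600 * exp 14 * √k by positivity]
    have h2 : (20 * σ) ^ 2 ≤ D ^ 2 := pow_le_pow_left₀ (by positivity) h1 2
    rw [mul_pow, Real.sq_sqrt (Nat.cast_nonneg m)]
    nlinarith [(Nat.cast_nonneg m : (0 : ℝ) ≤ m)]
  have h1 := lintegral_seminorm_pow_stdGaussian_le N hσ.le hNσ (by positivity)
    (h.integral_seminorm_stdGaussian_le hk hνk N hσ hNσ hm hN) hσM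
  simp_rw [hN] at h1
  rw [lintegral_lintegral_swap (by fun_prop)] at h1
  simp_rw [lintegral_abs_inner_pow_stdGaussian] at h1
  rw [lintegral_mul_const _ (by fun_prop)] at h1
  have h2 := (mul_le_mul_right (le_lintegral_abs_pow_gaussianReal hm) _).trans h1
  set a := √m ^ m * exp (-(2 * m)) / 3 with ha
  have ha0 : 0 < a := by positivity
  have h3 : 2 * exp (2 * m) * (√m * D) ^ m ≤ (6 * exp 4 * D) ^ m * a := by
    have h4 : (6 : ℝ) ≤ 6 ^ m := le_self_pow₀ (by norm_num) (by omega)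
    have h5 : exp 4 ^ m * exp (-(2 * m)) = exp (2 * m) := by
      rw [← exp_nat_mul, ← exp_add]; ring_nf
    calc 2 * exp (2 * m) * (√m * D) ^ m = 6 * (exp (2 * m) * √m ^ m * D ^ m / 3) := by
          rw [mul_pow]; ring
      _ ≤ 6 ^ m * (exp (2 * m) * √m ^ m * D ^ m / 3) := by gcongr
      _ = (6 * exp 4 * D) ^ m * a := by
          rw [← h5, ha, mul_pow, mul_pow]; ring
  have h6 := h2.trans (ENNReal.ofReal_le_ofReal h3)
  rw [ENNReal.ofReal_mul (by positivity)] at h6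
  exact (ENNReal.mul_le_mul_iff_left (ENNReal.ofReal_pos.2 ha0).ne' ENNReal.ofReal_ne_top).1 h6

end NormMoments

section Isotropic

open Module

variable {μ : Measure Ω} [IsProbabilityMeasure μ] {n : ℕ}
  {X : Ω → EuclideanSpace ℝ (Fin n)}

lemma IsLogConcave.memLp (hX : Measurable X) (h : IsLogConcave μ X) (p : ℝ) :
    MemLp X (ENNReal.ofReal p) μ := by
  refine MemLp.of_eval_piLp fun i => ?_
  have : IsProbabilityMeasure (μ.map X) := Measure.isProbabilityMeasure_map hX.aemeasurable
  let T : EuclideanSpace ℝ (Fin n) →L[ℝ] ℝ := EuclideanSpace.proj i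
  have hT : Measurable T := T.continuous.measurable
  have : IsProbabilityMeasure ((μ.map X).map T) :=
    Measure.isProbabilityMeasure_map hT.aemeasurable
  set q := ⌈p⌉₊ + 1
  have h1 := ((h.logConcaveOnClosed hX).map T).lintegral_abs_pow_lt_top
    (show 1 ≤ q by omega)
  rw [lintegral_map (by fun_prop) hT, lintegral_map (by fun_prop) hX] at h1
  have h2 : MemLp (fun ω => X ω i) (q : ℝ≥0∞) μ := by
    refine ⟨by fun_prop, ?_⟩
    have h3 : eLpNorm (fun ω => X ω i) q μ ^ q < ⊤ := by
      rw [eLpNorm_natCast_pow μ _ (by omega)]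
      exact h1
    exact (ENNReal.pow_lt_top_iff.1 h3).resolve_right (by omega)
  refine h2.mono_exponent ?_
  rw [← ENNReal.ofReal_natCast]
  refine ENNReal.ofReal_le_ofReal ((Nat.le_ceil p).trans ?_)
  exact_mod_cast Nat.le_succ _

lemma IsLogConcave.eLpNorm_inner_le (hX : Measurable X) (h : IsLogConcave μ X) {p : ℝ}
    (hp : 1 ≤ p) (z : EuclideanSpace ℝ (Fin n)) :
    eLpNorm (fun ω => ⟪z, X ω⟫) (ENNReal.ofReal p) μ ≤ ENNReal.ofReal (sigmaX μ X p * ‖z‖) := by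
  have hp0 : ENNReal.ofReal p ≠ 0 := (ENNReal.ofReal_pos.2 (by linarith)).ne'
  have hmem := h.memLp hX p
  have hinner : ∀ z, MemLp (fun ω => ⟪z, X ω⟫) (ENNReal.ofReal p) μ := fun z =>
    hmem.const_inner z
  have hEq : ∀ z, eLpNorm (fun ω => ⟪z, X ω⟫) (ENNReal.ofReal p) μ =
      ENNReal.ofReal ((∫ ω, |⟪z, X ω⟫| ^ p ∂μ) ^ (1 / p)) := fun z => by
    rw [(hinner z).eLpNorm_eq_integral_rpow_norm hp0 ENNReal.ofReal_ne_top,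
      ENNReal.toReal_ofReal (by linarith)]
    simp only [Real.norm_eq_abs, one_div]
  have hbdd : BddAbove (Set.range fun t : {t : EuclideanSpace ℝ (Fin n) // ‖t‖ = 1} =>
      (∫ ω, |⟪t.1, X ω⟫| ^ p ∂μ) ^ (1 / p)) := by
    refine ⟨(eLpNorm X (ENNReal.ofReal p) μ).toReal, ?_⟩
    rintro _ ⟨t, rfl⟩
    have h1 : eLpNorm (fun ω => ⟪t.1, X ω⟫) (ENNReal.ofReal p) μ ≤
        eLpNorm X (ENNReal.ofReal p) μ := by
      refine eLpNorm_mono fun ω => ?_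
      have := norm_inner_le_norm (𝕜 := ℝ) t.1 (X ω)
      rwa [t.2, one_mul] at this
    rw [hEq] at h1
    exact (ENNReal.ofReal_le_iff_le_toReal hmem.2.ne).1 h1
  rcases eq_or_ne z 0 with rfl | hz
  · simp
  have hz' : 0 < ‖z‖ := norm_pos_iff.2 hz
  have hu : ‖‖z‖⁻¹ • z‖ = 1 := by
    rw [norm_smul, norm_inv, norm_norm, inv_mul_cancel₀ hz'.ne']
  have h2 : (fun ω => ⟪z, X ω⟫) = ‖z‖ • fun ω => ⟪‖z‖⁻¹ • z, X ω⟫ := by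
    ext ω
    rw [Pi.smul_apply, smul_eq_mul, real_inner_smul_left, mul_inv_cancel_left₀ hz'.ne']
  rw [h2, eLpNorm_const_smul, hEq, ← ofReal_norm, norm_norm, mul_comm (sigmaX μ X p),
    ENNReal.ofReal_mul (norm_nonneg _)]
  gcongr
  exact le_ciSup hbdd ⟨_, hu⟩

lemma IsLogConcave.lintegral_abs_inner_pow_le (hX : Measurable X) (h : IsLogConcave μ X)
    {p s : ℝ} (hs : sigmaX μ X p ≤ s) {m : ℕ} (hm : 1 ≤ m) (hmp : (m : ℝ) ≤ p)
    (z : EuclideanSpace ℝ (Fin n)) :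
    ∫⁻ ω, ENNReal.ofReal (|⟪z, X ω⟫| ^ m) ∂μ ≤ ENNReal.ofReal ((max s 0 * ‖z‖) ^ m) := by
  have hm1 : (1 : ℝ) ≤ m := by exact_mod_cast hm
  rw [← eLpNorm_natCast_pow μ _ (by omega), ENNReal.ofReal_pow (by positivity)]
  gcongr
  calc eLpNorm (fun ω => ⟪z, X ω⟫) m μ ≤ eLpNorm (fun ω => ⟪z, X ω⟫) (ENNReal.ofReal p) μ := by
        refine eLpNorm_le_eLpNorm_of_exponent_le ?_ (by fun_prop)
        rw [← ENNReal.ofReal_natCast]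
        exact ENNReal.ofReal_le_ofReal hmp
    _ ≤ ENNReal.ofReal (sigmaX μ X p * ‖z‖) := h.eLpNorm_inner_le hX (hm1.trans hmp) z
    _ ≤ _ := by
        gcongr
        exact hs.trans (le_max_left _ _)

/-- The orthogonal projection of `ℝⁿ` onto the coordinates in `I`. -/
def coordProj (I : Finset (Fin n)) : EuclideanSpace ℝ (Fin n) →L[ℝ] EuclideanSpace ℝ (Fin n) :=
  ((EuclideanSpace.equiv (Fin n) ℝ).symm : (Fin n → ℝ) →L[ℝ] EuclideanSpace ℝ (Fin n)) ∘L
    ContinuousLinearMap.pi fun i => if i ∈ I then EuclideanSpace.proj i else 0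

lemma coordProj_apply (I : Finset (Fin n)) (x : EuclideanSpace ℝ (Fin n)) (i : Fin n) :
    coordProj I x i = if i ∈ I then x i else 0 := by
  change (if i ∈ I then (EuclideanSpace.proj i : EuclideanSpace ℝ (Fin n) →L[ℝ] ℝ) else 0) x = _
  split_ifs <;> rfl

lemma norm_coordProj_sq (I : Finset (Fin n)) (x : EuclideanSpace ℝ (Fin n)) :
    ‖coordProj I x‖ ^ 2 = ∑ i ∈ I, x i ^ 2 := by
  rw [EuclideanSpace.norm_sq_eq]
  simp [coordProj_apply, ite_pow]

lemma norm_coordProj_le (I : Finset (Fin n)) (x : EuclideanSpace ℝ (Fin n)) :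
    ‖coordProj I x‖ ≤ ‖x‖ := by
  refine le_of_pow_le_pow_left₀ two_ne_zero (norm_nonneg _) ?_
  rw [norm_coordProj_sq, EuclideanSpace.norm_sq_eq]
  simp only [Real.norm_eq_abs, sq_abs]
  exact Finset.sum_le_univ_sum_of_nonneg fun i => sq_nonneg _

lemma inner_coordProj (I : Finset (Fin n)) (x y : EuclideanSpace ℝ (Fin n)) :
    ⟪x, coordProj I y⟫ = ⟪coordProj I x, y⟫ := by
  simp [PiLp.inner_apply, coordProj_apply]

omit [IsProbabilityMeasure μ] in
lemma IsIsotropic.lintegral_norm_coordProj_sq (hX : Measurable X) (h : IsIsotropic μ X)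
    (I : Finset (Fin n)) :
    ∫⁻ ω, ENNReal.ofReal (‖coordProj I (X ω)‖ ^ 2) ∂μ = ENNReal.ofReal I.card := by
  have h1 : ∀ i, ∫⁻ ω, ENNReal.ofReal (X ω i ^ 2) ∂μ = 1 := fun i => by
    have h2 := h.2 i i
    simp only [if_true, ← sq] at h2
    rw [← ofReal_integral_eq_lintegral_ofReal (integrable_of_integral_eq_one h2)
      (ae_of_all _ fun ω => sq_nonneg _), h2, ENNReal.ofReal_one]
  simp_rw [norm_coordProj_sq]
  simp_rw [ENNReal.ofReal_sum_of_nonneg fun i _ => sq_nonneg _]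
  rw [lintegral_finsetSum _ fun i _ => by fun_prop]
  simp [h1]

lemma exp_hundred_constant_bound {t : ℝ} (ht : 0 ≤ t) {k : ℝ} (hk : exp 100 * k ≤ t) :
    6 * exp 4 * (20 * (√t / exp 100) + 1600 * exp 14 * √k) ≤ exp (-2) * √t := by
  have h1 : √k ≤ exp (-50) * √t := by
    refine Real.sqrt_le_iff.2 ⟨by positivity, ?_⟩
    rw [mul_pow, Real.sq_sqrt ht, ← exp_nat_mul, show ((2 : ℕ) : ℝ) * -50 = -100 by norm_num,
      exp_neg, ← div_eq_inv_mul, le_div_iff₀' (exp_pos _)]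
    exact hk
  have h2 : (2 : ℝ) ^ 20 ≤ exp 20 := by
    have := pow_le_pow_left₀ (by norm_num) (show (2 : ℝ) ≤ exp 1 by
      linarith [add_one_le_exp (1 : ℝ)]) 20
    rwa [← exp_nat_mul, show ((20 : ℕ) : ℝ) * 1 = 20 by norm_num] at this
  have h3 : (9720 : ℝ) * exp (-30) ≤ exp (-2) := by
    have h4 : exp (-2) = exp (-30) * (exp 20 * exp 8) := by
      rw [← exp_add, ← exp_add]; norm_num
    have h5 : (1 : ℝ) ≤ exp 8 := one_le_exp (by norm_num)
    rw [h4, mul_comm]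
    gcongr
    norm_num at h2
    nlinarith
  have h6 : exp 4 * exp (-100) ≤ exp (-30) := by
    rw [← exp_add]
    exact exp_le_exp.2 (by norm_num)
  have h7 : exp 4 * (exp 14 * exp (-50)) ≤ exp (-30) := by
    rw [← exp_add, ← exp_add]
    exact exp_le_exp.2 (by norm_num)
  have h8 : √t / exp 100 = exp (-100) * √t := by rw [exp_neg]; ring
  calc 6 * exp 4 * (20 * (√t / exp 100) + 1600 * exp 14 * √k)
      ≤ 6 * exp 4 * (20 * (exp (-100) * √t) + 1600 * exp 14 * (exp (-50) * √t)) := by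
        rw [h8]; gcongr
    _ = (120 * (exp 4 * exp (-100)) + 9600 * (exp 4 * (exp 14 * exp (-50)))) * √t := by ring
    _ ≤ (120 * exp (-30) + 9600 * exp (-30)) * √t := by gcongr
    _ = 9720 * exp (-30) * √t := by ring
    _ ≤ exp (-2) * √t := by gcongr

lemma IsLogConcave.measure_sum_sq_ge_le (hX : Measurable X) (h : IsLogConcave μ X)
    (hiso : IsIsotropic μ X) {I : Finset (Fin n)} (hI : I.Nonempty) {t : ℝ}
    (ht : exp 100 * (I.card : ℝ) ≤ t) {p : ℝ} (hp : 1 ≤ p)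
    (hσ : sigmaX μ X p ≤ √t / exp 100) :
    μ {ω | t ≤ ∑ i ∈ I, (X ω i) ^ 2} ≤ ENNReal.ofReal (exp (-p)) := by
  have hk : (0 : ℝ) < I.card := by exact_mod_cast hI.card_pos
  have ht0 : 0 < t := lt_of_lt_of_le (by positivity) ht
  have hs : 0 < √t / exp 100 := by positivity
  have hm : 1 ≤ ⌊p⌋₊ := Nat.le_floor (by simpa using hp)
  have hmp : (⌊p⌋₊ : ℝ) ≤ p := Nat.floor_le (by linarith)
  have hpm : p ≤ 2 * ⌊p⌋₊ := by
    have h1 := Nat.lt_floor_add_one p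
    have h2 : (1 : ℝ) ≤ ⌊p⌋₊ := by exact_mod_cast hm
    linarith
  set m := ⌊p⌋₊
  have hTm : Measurable (coordProj I) := (coordProj I).continuous.measurable
  have : IsProbabilityMeasure (μ.map X) := Measure.isProbabilityMeasure_map hX.aemeasurable
  have : IsProbabilityMeasure ((μ.map X).map (coordProj I)) :=
    Measure.isProbabilityMeasure_map hTm.aemeasurable
  have hmain := ((h.logConcaveOnClosed hX).map (coordProj I)).lintegral_norm_pow_le hk (by
    rw [lintegral_map (by fun_prop) hTm, lintegral_map (by fun_prop) hX]
    exact (hiso.lintegral_norm_coordProj_sq hX I).le) hs hm (fun x => by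
    rw [lintegral_map (by fun_prop) hTm, lintegral_map (by fun_prop) hX]
    simp_rw [inner_coordProj]
    refine (h.lintegral_abs_inner_pow_le hX hσ hm hmp _).trans (ENNReal.ofReal_le_ofReal ?_)
    rw [max_eq_left hs.le]
    gcongr
    exact norm_coordProj_le I x)
  rw [lintegral_map (by fun_prop) hTm, lintegral_map (by fun_prop) hX] at hmain
  have h1 : ENNReal.ofReal (√t ^ m) * μ {ω | t ≤ ∑ i ∈ I, (X ω i) ^ 2} ≤
      ENNReal.ofReal (√t ^ m) * ENNReal.ofReal (exp (-p)) := by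
    calc ENNReal.ofReal (√t ^ m) * μ {ω | t ≤ ∑ i ∈ I, (X ω i) ^ 2}
        ≤ ENNReal.ofReal (√t ^ m) *
          μ {ω | ENNReal.ofReal (√t ^ m) ≤ ENNReal.ofReal (‖coordProj I (X ω)‖ ^ m)} := by
          gcongr with ω
          intro hω
          rw [← norm_coordProj_sq] at hω
          gcongr
          exact Real.sqrt_le_iff.2 ⟨norm_nonneg _, hω⟩
      _ ≤ _ := mul_meas_ge_le_lintegral₀ (by fun_prop) _
      _ ≤ _ := hmain
      _ ≤ _ := by
          rw [← ENNReal.ofReal_mul (by positivity)]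
          refine ENNReal.ofReal_le_ofReal ?_
          calc _ ≤ (exp (-2) * √t) ^ m :=
                pow_le_pow_left₀ (by positivity) (exp_hundred_constant_bound ht0.le ht) m
            _ = √t ^ m * exp (-(2 * m)) := by
                rw [mul_pow, ← exp_nat_mul, mul_comm]; ring_nf
            _ ≤ √t ^ m * exp (-p) := by gcongr
  exact (ENNReal.mul_le_mul_iff_right (ENNReal.ofReal_pos.2 (by positivity)).ne'
    ENNReal.ofReal_ne_top).1 h1

end Isotropic

/-- There is a universal constant `C > 0` such that for every isotropic log-concave random
vector `X` in `ℝⁿ`, every nonempty `I ⊆ {1,…,n}` and every `t ≥ C·|I|`,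
`P(∑_{i ∈ I} Xᵢ² ≥ t) ≤ exp(−σ_X⁻¹(√t / C))`. -/
theorem projection_tail :
    ∃ C : ℝ, 0 < C ∧
      ∀ (Ω : Type) (_ : MeasurableSpace Ω) (μ : Measure Ω), IsProbabilityMeasure μ →
      ∀ (n : ℕ) (X : Ω → EuclideanSpace ℝ (Fin n)), Measurable X →
      IsLogConcave μ X → IsIsotropic μ X →
      ∀ I : Finset (Fin n), I.Nonempty →
      ∀ t : ℝ, C * (I.card : ℝ) ≤ t →
        (μ {ω | t ≤ ∑ i ∈ I, (X ω i) ^ 2}).toReal ≤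
          Real.exp (-(sigmaXInv μ X (Real.sqrt t / C))) := by
  refine ⟨exp 100, exp_pos _, fun Ω _ μ _ n X hX h hiso I hI t ht => ?_⟩
  set P := (μ {ω | t ≤ ∑ i ∈ I, (X ω i) ^ 2}).toReal with hP
  rcases (ENNReal.toReal_nonneg : 0 ≤ P).eq_or_lt with h0 | h0
  · exact h0.symm.le.trans (exp_pos _).le
  have h1 : sigmaXInv μ X (√t / exp 100) ≤ -Real.log P := by
    refine Real.sSup_le (fun p hp => ?_) ?_
    · rw [le_neg, Real.log_le_iff_le_exp h0]
      exact ENNReal.toReal_le_of_le_ofReal (exp_pos _).le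
        (h.measure_sum_sq_ge_le hX hiso hI ht hp.1 hp.2)
    · have : Real.log P ≤ 0 := Real.log_nonpos h0.le measureReal_le_one
      linarith
  calc P = exp (Real.log P) := (Real.exp_log h0).symm
    _ ≤ _ := exp_le_exp.2 (by linarith)

end
end

section
/- Let Y be a log-concave real random variable (not necessarily centered). Then for every p ≥ 2, (E|Y|^p)^{1/p} ≤ (p+1)·(E Y²)^{1/2}. -/
open MeasureTheory Real
open scoped Pointwise

noncomputable section

variable {Ω : Type*} [MeasurableSpace Ω]

/-- A real random variable `Y` is log-concave: for all nonempty compact sets `K, L ⊆ ℝ` and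
`a ∈ [0,1]`, `P(Y ∈ aK + (1-a)L) ≥ P(Y ∈ K)^a * P(Y ∈ L)^(1-a)`. -/
def IsLogConcaveRV (μ : Measure Ω) (Y : Ω → ℝ) : Prop :=
  ∀ K L : Set ℝ, K.Nonempty → L.Nonempty → IsCompact K → IsCompact L →
    ∀ a : ℝ, 0 ≤ a → a ≤ 1 →
      (μ (Y ⁻¹' K)).toReal ^ a * (μ (Y ⁻¹' L)).toReal ^ (1 - a) ≤
        (μ (Y ⁻¹' (a • K + (1 - a) • L))).toReal

lemma IsLogConcaveRV.const_mul {μ : Measure Ω} {Y : Ω → ℝ} (h : IsLogConcaveRV μ Y)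
    {c : ℝ} (hc : c ≠ 0) : IsLogConcaveRV μ (fun ω => c * Y ω) := by
  have key : ∀ K : Set ℝ, (fun ω => c * Y ω) ⁻¹' K = Y ⁻¹' (c⁻¹ • K) := by
    intro K
    ext ω
    rw [Set.mem_preimage, Set.mem_preimage, Set.mem_inv_smul_set_iff₀ hc, smul_eq_mul]
  intro K L hK hL hKc hLc a ha0 ha1
  rw [key, key, key, smul_add, smul_comm c⁻¹ a K, smul_comm c⁻¹ (1 - a) L]
  exact h _ _ hK.smul_set hL.smul_set (hKc.smul _) (hLc.smul _) a ha0 ha1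

/-- A nonnegative function on the line is log-concave. -/
def LogConcaveFun (G : ℝ → ℝ) : Prop :=
  ∀ x y a : ℝ, 0 < a → a < 1 → G x ^ a * G y ^ (1 - a) ≤ G (a * x + (1 - a) * y)

lemma tendsto_measureReal_preimage_Icc (μ : Measure Ω) [IsFiniteMeasure μ] (Y : Ω → ℝ) (x : ℝ) :
    Filter.Tendsto (fun n : ℕ => (μ (Y ⁻¹' Set.Icc (x + 1 / ((n : ℝ) + 1)) (x + n + 1))).toReal)
      Filter.atTop (nhds (μ.real {ω | x < Y ω})) := by
  have hmono : Monotone (fun n : ℕ => Y ⁻¹' Set.Icc (x + 1 / ((n : ℝ) + 1)) (x + n + 1)) := by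
    intro m n hmn
    apply Set.preimage_mono
    have h : (m : ℝ) ≤ n := by exact_mod_cast hmn
    apply Set.Icc_subset_Icc
    · gcongr
    · linarith
  have hU : (⋃ n : ℕ, Y ⁻¹' Set.Icc (x + 1 / ((n : ℝ) + 1)) (x + n + 1)) = {ω | x < Y ω} := by
    ext ω
    simp only [Set.mem_iUnion, Set.mem_preimage, Set.mem_Icc, Set.mem_ofPred_eq]
    constructor
    · rintro ⟨n, h, -⟩
      have : (0 : ℝ) < 1 / ((n : ℝ) + 1) := by positivity
      linarith
    · intro h
      obtain ⟨m, hm⟩ := exists_nat_one_div_lt (sub_pos.2 h)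
      obtain ⟨k, hk⟩ := exists_nat_ge (Y ω - x)
      refine ⟨max m k, ?_, ?_⟩
      · have : 1 / (((max m k : ℕ) : ℝ) + 1) ≤ 1 / ((m : ℝ) + 1) := by
          gcongr
          exact le_max_left _ _
        linarith
      · have : (k : ℝ) ≤ ((max m k : ℕ) : ℝ) := by exact_mod_cast le_max_right _ _
        linarith
  have h := tendsto_measure_iUnion_atTop (μ := μ) hmono
  rw [hU] at h
  exact (ENNReal.tendsto_toReal (measure_ne_top _ _)).comp h

lemma IsLogConcaveRV.logConcaveFun_tail {μ : Measure Ω} [IsFiniteMeasure μ] {Y : Ω → ℝ}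
    (h : IsLogConcaveRV μ Y) : LogConcaveFun (fun t => μ.real {ω | t < Y ω}) := by
  intro x y a ha0 ha1
  have hne : ∀ (x : ℝ) (n : ℕ), (Set.Icc (x + 1 / ((n : ℝ) + 1)) (x + n + 1)).Nonempty := by
    intro x n
    rw [Set.nonempty_Icc]
    have : 1 / ((n : ℝ) + 1) ≤ 1 := by
      rw [div_le_one (by positivity)]
      linarith [n.cast_nonneg (α := ℝ)]
    linarith [n.cast_nonneg (α := ℝ)]
  refine le_of_tendsto (((tendsto_measureReal_preimage_Icc μ Y x).rpow_const (Or.inr ha0.le)).mul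
    ((tendsto_measureReal_preimage_Icc μ Y y).rpow_const (Or.inr (sub_nonneg.2 ha1.le))))
    (Filter.Eventually.of_forall fun n => ?_)
  refine (h _ _ (hne x n) (hne y n) isCompact_Icc isCompact_Icc a ha0.le ha1.le).trans ?_
  refine measureReal_mono ?_
  rintro ω ⟨_, ⟨u, hu, rfl⟩, _, ⟨v, hv, rfl⟩, huv⟩
  simp only [smul_eq_mul] at huv
  rw [Set.mem_ofPred_eq, ← huv]
  have hn : (0 : ℝ) < 1 / ((n : ℝ) + 1) := by positivity
  have hu' : x < u := by linarith [hu.1]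
  have hv' : y < v := by linarith [hv.1]
  have h1 : 0 < 1 - a := by linarith
  have := mul_lt_mul_of_pos_left hu' ha0
  have := mul_lt_mul_of_pos_left hv' h1
  linarith

/-- The superlevel sets of a log-concave function relative to an exponential are convex. -/
lemma LogConcaveFun.exp_le_of_le {G : ℝ → ℝ} (hG : LogConcaveFun G) {c L x y z : ℝ}
    (hc : 0 ≤ c) (hxy : x < y) (hyz : y < z) (hx : c * exp (-(L * x)) ≤ G x)
    (hz : c * exp (-(L * z)) ≤ G z) : c * exp (-(L * y)) ≤ G y := by
  obtain ⟨a, ha⟩ : ∃ a, a = (z - y) / (z - x) := ⟨_, rfl⟩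
  have hzx : 0 < z - x := by linarith
  have ha0 : 0 < a := by rw [ha]; exact div_pos (by linarith) hzx
  have ha1 : a < 1 := by rw [ha, div_lt_one hzx]; linarith
  have hy : a * x + (1 - a) * z = y := by rw [ha]; field_simp; ring
  have h := hG x z a ha0 ha1
  rw [hy] at h
  refine le_trans ?_ h
  calc c * exp (-(L * y))
      = (c * exp (-(L * x))) ^ a * (c * exp (-(L * z))) ^ (1 - a) := by
        rw [mul_rpow hc (exp_pos _).le, mul_rpow hc (exp_pos _).le, ← exp_mul, ← exp_mul,
          mul_mul_mul_comm, ← rpow_add' hc (by simp), ← exp_add, ← hy]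
        simp only [add_sub_cancel, rpow_one]
        ring_nf
    _ ≤ _ := by
        have hx0 : 0 ≤ c * exp (-(L * x)) := by positivity
        have hz0 : 0 ≤ c * exp (-(L * z)) := by positivity
        have h1 : 0 ≤ 1 - a := by linarith
        exact mul_le_mul (rpow_le_rpow hx0 hx ha0.le) (rpow_le_rpow hz0 hz h1)
          (rpow_nonneg hz0 _) (rpow_nonneg (hx0.trans hx) _)

lemma integrableOn_rpow_sub_one_mul_exp {p L : ℝ} (hp : 0 < p) (hL : 0 < L) (c : ℝ) :
    IntegrableOn (fun t : ℝ => t ^ (p - 1) * (c * exp (-(L * t)))) (Set.Ioi 0) := by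
  refine IntegrableOn.congr_fun ((integrableOn_rpow_mul_exp_neg_mul_rpow (p := 1) (s := p - 1)
    (b := L) (by linarith) one_pos hL).const_mul c) (fun t _ => ?_) measurableSet_Ioi
  simp only [rpow_one, neg_mul]
  ring

lemma integral_rpow_sub_one_mul_exp {p L : ℝ} (hp : 0 < p) (hL : 0 < L) (c : ℝ) :
    ∫ t in Set.Ioi (0 : ℝ), t ^ (p - 1) * (c * exp (-(L * t))) =
      c * ((1 / L) ^ p * Gamma p) := by
  rw [← integral_rpow_mul_exp_neg_mul_Ioi hp hL, ← integral_const_mul]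
  congr 1
  ext t
  ring

lemma lintegral_rpow_sub_one_mul_exp {p L c : ℝ} (hp : 0 < p) (hL : 0 < L) (hc : 0 ≤ c) :
    ∫⁻ t in Set.Ioi (0 : ℝ), ENNReal.ofReal (t ^ (p - 1) * (c * exp (-(L * t)))) =
      ENNReal.ofReal (c * ((1 / L) ^ p * Gamma p)) := by
  rw [← integral_rpow_sub_one_mul_exp hp hL,
    ofReal_integral_eq_lintegral_ofReal (integrableOn_rpow_sub_one_mul_exp hp hL c)]
  filter_upwards [ae_restrict_mem measurableSet_Ioi] with t ht
  have : (0 : ℝ) < t := ht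
  positivity

/-- If an antitone log-concave function has a smaller first moment than the exponential with the
same value at `0`, then it has smaller higher moments. -/
lemma LogConcaveFun.lintegral_rpow_le {G : ℝ → ℝ} (hG : LogConcaveFun G) (hanti : Antitone G)
    (hpos : ∀ t, 0 ≤ G t) {p L : ℝ} (hp : 2 ≤ p) (hL : 0 < L)
    (h2 : ∫⁻ t in Set.Ioi (0 : ℝ), ENNReal.ofReal (t ^ ((2 : ℝ) - 1) * G t) <
      ENNReal.ofReal (G 0 * ((1 / L) ^ (2 : ℝ) * Gamma 2))) :
    ∫⁻ t in Set.Ioi (0 : ℝ), ENNReal.ofReal (t ^ (p - 1) * G t) ≤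
      ENNReal.ofReal (G 0 * ((1 / L) ^ p * Gamma p)) := by
  set S : Set ℝ := {t | 0 < t ∧ G t < G 0 * exp (-(L * t))} with hS
  have hSne : S.Nonempty := by
    by_contra hne
    rw [Set.not_nonempty_iff_eq_empty] at hne
    refine h2.not_ge ?_
    rw [← lintegral_rpow_sub_one_mul_exp two_pos hL (hpos 0)]
    refine setLIntegral_mono' measurableSet_Ioi fun t ht => ?_
    have ht0 : (0 : ℝ) < t := ht
    have : t ∉ S := by simp [hne]
    simp only [hS, Set.mem_ofPred_eq, not_and, not_lt] at this
    gcongr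
    exact this ht0
  have hbdd : BddBelow S := ⟨0, fun t ht => ht.1.le⟩
  set x₀ := sInf S with hx₀
  have hx₀0 : 0 ≤ x₀ := le_csInf hSne fun t ht => ht.1.le
  have hlow : ∀ t, 0 < t → t < x₀ → G 0 * exp (-(L * t)) ≤ G t := by
    intro t ht htx
    by_contra hlt
    exact htx.not_ge (csInf_le hbdd ⟨ht, not_le.1 hlt⟩)
  have hhigh : ∀ t, x₀ < t → G t ≤ G 0 * exp (-(L * t)) := by
    intro t ht
    obtain ⟨s, hs, hst⟩ := exists_lt_of_csInf_lt hSne ht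
    by_contra hlt
    exact hs.2.not_ge (hG.exp_le_of_le (hpos 0) hs.1 hst (by simp) (not_le.1 hlt).le)
  have hexp : ∀ t, 0 < t → G t ≤ (G 0 * exp (L * x₀)) * exp (-(L * t)) := by
    intro t ht
    rcases lt_or_ge x₀ t with h | h
    · refine (hhigh t h).trans ?_
      have : 1 ≤ exp (L * x₀) := one_le_exp (by positivity)
      have h0 := hpos 0
      gcongr
      exact le_mul_of_one_le_right h0 this
    · refine (hanti ht.le).trans ?_
      rw [mul_assoc, ← exp_add]
      exact le_mul_of_one_le_right (hpos 0) (one_le_exp (by nlinarith))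
  have hint : ∀ q : ℝ, 0 < q → IntegrableOn (fun t => t ^ (q - 1) * G t) (Set.Ioi 0) := by
    intro q hq
    refine (integrableOn_rpow_sub_one_mul_exp hq hL (G 0 * exp (L * x₀))).mono'
      (Measurable.aestronglyMeasurable
        ((measurable_id.pow_const _).mul hanti.measurable)) ?_
    filter_upwards [ae_restrict_mem measurableSet_Ioi] with t ht
    have ht0 : (0 : ℝ) < t := ht
    rw [norm_of_nonneg (mul_nonneg (by positivity) (hpos t))]
    have := hexp t ht0
    gcongr
  have hnn : ∀ q : ℝ, 0 ≤ᵐ[volume.restrict (Set.Ioi (0 : ℝ))] fun t => t ^ (q - 1) * G t := by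
    intro q
    filter_upwards [ae_restrict_mem measurableSet_Ioi] with t ht
    exact mul_nonneg (rpow_nonneg (le_of_lt ht) _) (hpos t)
  rw [← ofReal_integral_eq_lintegral_ofReal (hint 2 two_pos) (hnn 2)] at h2
  have hp0 : 0 < p := by linarith
  rw [← ofReal_integral_eq_lintegral_ofReal (hint p hp0) (hnn p)]
  apply ENNReal.ofReal_le_ofReal
  have h2' := (ENNReal.ofReal_lt_ofReal_iff'.1 h2).1
  rw [← integral_rpow_sub_one_mul_exp two_pos hL] at h2'
  rw [← integral_rpow_sub_one_mul_exp hp0 hL]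
  have hI2 := (hint 2 two_pos).sub (integrableOn_rpow_sub_one_mul_exp two_pos hL (G 0))
  have hIp := (hint p hp0).sub (integrableOn_rpow_sub_one_mul_exp hp0 hL (G 0))
  have hmono : ∫ t in Set.Ioi (0 : ℝ), (t ^ (p - 1) * G t - t ^ (p - 1) * (G 0 * exp (-(L * t)))) ≤
      ∫ t in Set.Ioi (0 : ℝ), x₀ ^ (p - 2) *
        (t ^ ((2 : ℝ) - 1) * G t - t ^ ((2 : ℝ) - 1) * (G 0 * exp (-(L * t)))) := by
    refine setIntegral_mono_on hIp (hI2.const_mul _) measurableSet_Ioi fun t ht => ?_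
    have ht0 : (0 : ℝ) < t := ht
    have hsplit : t ^ (p - 1) = t ^ (p - 2) * t ^ ((2 : ℝ) - 1) := by
      rw [← rpow_add ht0]
      ring_nf
    have hdiff : (t ^ (p - 2) - x₀ ^ (p - 2)) * (G t - G 0 * exp (-(L * t))) ≤ 0 := by
      rcases lt_trichotomy t x₀ with h | h | h
      · exact mul_nonpos_of_nonpos_of_nonneg
          (sub_nonpos.2 (rpow_le_rpow ht0.le h.le (by linarith)))
          (sub_nonneg.2 (hlow t ht0 h))
      · simp [h]
      · exact mul_nonpos_of_nonneg_of_nonpos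
          (sub_nonneg.2 (rpow_le_rpow hx₀0 h.le (by linarith)))
          (sub_nonpos.2 (hhigh t h))
    have := mul_nonpos_of_nonneg_of_nonpos (rpow_nonneg ht0.le ((2 : ℝ) - 1)) hdiff
    rw [hsplit]
    linarith
  rw [integral_const_mul,
    integral_sub (hint p hp0) (integrableOn_rpow_sub_one_mul_exp hp0 hL (G 0)),
    integral_sub (hint 2 two_pos) (integrableOn_rpow_sub_one_mul_exp two_pos hL (G 0))] at hmono
  have := mul_nonpos_of_nonneg_of_nonpos (rpow_nonneg hx₀0 (p - 2)) (sub_nonpos.2 h2'.le)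
  linarith

lemma lintegral_rpow_max_zero (μ : Measure Ω) [IsFiniteMeasure μ] {X : Ω → ℝ} (hX : Measurable X)
    {p : ℝ} (hp : 0 < p) :
    ∫⁻ ω, ENNReal.ofReal (max (X ω) 0 ^ p) ∂μ = ENNReal.ofReal p *
      ∫⁻ t in Set.Ioi (0 : ℝ), ENNReal.ofReal (t ^ (p - 1) * μ.real {ω | t < X ω}) := by
  rw [lintegral_rpow_eq_lintegral_meas_lt_mul μ (f := fun ω => max (X ω) 0)
    (Filter.Eventually.of_forall fun ω => le_max_right _ _)
    (hX.max measurable_const).aemeasurable hp]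
  congr 1
  refine setLIntegral_congr_fun measurableSet_Ioi fun t ht => ?_
  have ht0 : (0 : ℝ) < t := ht
  have hset : {ω | t < max (X ω) 0} = {ω | t < X ω} := by
    ext ω
    simp [ht0.le]
  simp only [hset]
  rw [ENNReal.ofReal_mul (rpow_nonneg ht0.le _), ofReal_measureReal, mul_comm]

/-- The positive part of a log-concave random variable with second moment at most `1` is
dominated in higher moments by an exponential variable. -/
lemma IsLogConcaveRV.lintegral_rpow_max_zero_le {μ : Measure Ω} [IsProbabilityMeasure μ]
    {X : Ω → ℝ} (hX : Measurable X) (h : IsLogConcaveRV μ X)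
    (hint : Integrable (fun ω => X ω ^ 2) μ) (h1 : ∫ ω, X ω ^ 2 ∂μ ≤ 1) {p : ℝ} (hp : 2 ≤ p) :
    ∫⁻ ω, ENNReal.ofReal (max (X ω) 0 ^ p) ∂μ ≤
      ENNReal.ofReal (μ.real {ω | 0 < X ω} * ((25 / 16 : ℝ) ^ p * Gamma (p + 1))) := by
  have hp0 : 0 < p := by linarith
  obtain ⟨G, hGdef⟩ : ∃ G : ℝ → ℝ, G = fun t => μ.real {ω | t < X ω} := ⟨_, rfl⟩
  have hG : LogConcaveFun G := hGdef ▸ h.logConcaveFun_tail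
  have hpos : ∀ t, 0 ≤ G t := fun t => by rw [hGdef]; exact measureReal_nonneg
  have hanti : Antitone G := by
    rw [hGdef]
    exact fun s t hst => measureReal_mono fun ω hω => lt_of_le_of_lt hst hω
  have hL : (0 : ℝ) < 16 / 25 := by norm_num
  have key : ∫⁻ t in Set.Ioi (0 : ℝ), ENNReal.ofReal (t ^ (p - 1) * G t) ≤
      ENNReal.ofReal (G 0 * ((1 / (16 / 25 : ℝ)) ^ p * Gamma p)) := by
    rcases le_or_gt (21 / 100) (G 0) with hθ | hθ
    · refine hG.lintegral_rpow_le hanti hpos hp hL ?_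
      have hcake := lintegral_rpow_max_zero μ hX two_pos
      have hle : ∫⁻ ω, ENNReal.ofReal (max (X ω) 0 ^ (2 : ℝ)) ∂μ ≤ 1 := by
        calc ∫⁻ ω, ENNReal.ofReal (max (X ω) 0 ^ (2 : ℝ)) ∂μ
            ≤ ∫⁻ ω, ENNReal.ofReal (X ω ^ 2) ∂μ := by
              refine lintegral_mono fun ω => ENNReal.ofReal_le_ofReal ?_
              rw [rpow_two]
              rcases le_total (X ω) 0 with h0 | h0
              · rw [max_eq_right h0]
                nlinarith
              · rw [max_eq_left h0]
          _ = ENNReal.ofReal (∫ ω, X ω ^ 2 ∂μ) :=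
              (ofReal_integral_eq_lintegral_ofReal hint
                (Filter.Eventually.of_forall fun ω => sq_nonneg _)).symm
          _ ≤ 1 := ENNReal.ofReal_le_one.2 h1
      rw [hcake, mul_comm] at hle
      have hhalf : ∫⁻ t in Set.Ioi (0 : ℝ),
          ENNReal.ofReal (t ^ ((2 : ℝ) - 1) * μ.real {ω | t < X ω}) ≤ ENNReal.ofReal (1 / 2) := by
        rw [ENNReal.ofReal_div_of_pos two_pos, ENNReal.ofReal_one,
          ENNReal.le_div_iff_mul_le (by simp) (by simp)]
        exact hle
      rw [hGdef] at hθ ⊢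
      refine hhalf.trans_lt ((ENNReal.ofReal_lt_ofReal_iff_of_nonneg (by norm_num)).2 ?_)
      rw [Gamma_two, rpow_two]
      linarith
    · have hmarkov : 369 / 625 ≤ G (-(25 / 16)) := by
        have hm := mul_meas_ge_le_integral_of_nonneg
          (Filter.Eventually.of_forall fun ω => sq_nonneg (X ω)) hint ((25 / 16) ^ 2)
        have hc : μ.real {ω | -(25 / 16) < X ω} + μ.real {ω | -(25 / 16) < X ω}ᶜ = 1 :=
          probReal_add_probReal_compl (measurableSet_lt measurable_const hX)
        have hs : μ.real {ω | -(25 / 16) < X ω}ᶜ ≤ μ.real {ω | (25 / 16) ^ 2 ≤ X ω ^ 2} := by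
          refine measureReal_mono fun ω hω => ?_
          simp only [Set.mem_compl_iff, Set.mem_ofPred_eq, not_lt] at hω ⊢
          nlinarith
        rw [hGdef]
        linarith
      rw [← lintegral_rpow_sub_one_mul_exp hp0 hL (hpos 0)]
      refine setLIntegral_mono' measurableSet_Ioi fun x hx => ENNReal.ofReal_le_ofReal ?_
      have hx0 : (0 : ℝ) < x := hx
      refine mul_le_mul_of_nonneg_left ?_ (rpow_nonneg hx0.le _)
      by_contra! hlt
      have he : G 0 < G (-(25 / 16)) * exp (-1) := by
        rw [exp_neg, ← div_eq_mul_inv, lt_div_iff₀ (exp_pos _)]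
        have := exp_one_lt_d9
        nlinarith [hpos 0, exp_pos 1]
      have hr : G 0 < G x * exp (16 / 25 * x) := by
        rw [exp_neg, ← div_eq_mul_inv, div_lt_iff₀ (exp_pos _)] at hlt
        exact hlt
      refine (lt_min he hr).not_ge ?_
      have := hG.exp_le_of_le (c := min (G (-(25 / 16)) * exp (-1)) (G x * exp (16 / 25 * x)))
        (L := 16 / 25) (x := -(25 / 16)) (y := 0) (z := x)
        ((hpos 0).trans (lt_min he hr).le) (by norm_num) hx0 ?_ ?_
      · simpa using this
      · calc _ ≤ (G (-(25 / 16)) * exp (-1)) * exp (-(16 / 25 * -(25 / 16))) := by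
              gcongr
              exact min_le_left _ _
          _ = _ := by
              rw [mul_assoc, ← exp_add]
              norm_num
      · calc _ ≤ (G x * exp (16 / 25 * x)) * exp (-(16 / 25 * x)) := by
              gcongr
              exact min_le_right _ _
          _ = _ := by
              rw [mul_assoc, ← exp_add]
              simp
  rw [lintegral_rpow_max_zero μ hX hp0]
  rw [hGdef] at key
  refine (mul_le_mul_right key (ENNReal.ofReal p)).trans ?_
  rw [← ENNReal.ofReal_mul hp0.le, Gamma_add_one hp0.ne', one_div_div]
  apply le_of_eq
  congr 1
  ring

lemma Gamma_add_one_le_rpow {p : ℝ} (hp : 2 ≤ p) :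
    (25 / 16 : ℝ) ^ p * Gamma (p + 1) ≤ (p + 1) ^ p := by
  have hp1 : 0 < p + 1 := by linarith
  have hb : (p + 1 : ℝ) ≤ (16 / 25 * exp 1) ^ p := by
    have he : (1739 / 1000 : ℝ) ≤ 16 / 25 * exp 1 := by
      have := exp_one_gt_d9
      linarith
    calc p + 1 ≤ (1 + 739 / 1000) ^ (2 : ℝ) * (1 + 739 / 1000) ^ (p - 2) := by
          rcases le_or_gt 1 (p - 2) with h | h
          · have := one_add_mul_self_le_rpow_one_add (s := 739 / 1000) (by norm_num) h
            rw [rpow_two]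
            nlinarith
          · have h0 : 0 ≤ p - 2 := by linarith
            have := add_one_le_exp ((p - 2) * log (1 + 739 / 1000))
            have hlog : (2 / 5 : ℝ) ≤ log (1 + 739 / 1000) := by
              have := one_sub_inv_le_log_of_pos (x := 1 + 739 / 1000) (by norm_num)
              norm_num at this ⊢
              linarith
            rw [rpow_two, rpow_def_of_pos (by norm_num) (p - 2),
              mul_comm (log _)]
            nlinarith
      _ = (1739 / 1000 : ℝ) ^ p := by
          rw [← rpow_add (by norm_num)]
          norm_num
      _ ≤ _ := rpow_le_rpow (by norm_num) he (by linarith)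
  have hpt : ∀ x : ℝ, 0 < x → x ^ p ≤ ((p + 1) / exp 1) ^ p * exp (p / (p + 1) * x) := by
    intro x hx
    have h := add_one_le_exp (x / (p + 1) - 1)
    rw [sub_add_cancel, exp_sub, div_le_div_iff₀ hp1 (exp_pos _)] at h
    have h' : x ≤ (p + 1) / exp 1 * exp (x / (p + 1)) := by
      rw [div_mul_eq_mul_div, le_div_iff₀ (exp_pos _)]
      linarith
    calc x ^ p ≤ ((p + 1) / exp 1 * exp (x / (p + 1))) ^ p :=
          rpow_le_rpow hx.le h' (by linarith)
      _ = _ := by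
          rw [mul_rpow (by positivity) (exp_pos _).le, ← exp_mul]
          ring_nf
  have hneg : -(1 / (p + 1)) < 0 := by
    rw [neg_lt_zero]
    positivity
  have hG : Gamma (p + 1) ≤ ((p + 1) / exp 1) ^ p * (p + 1) := by
    rw [Gamma_eq_integral hp1]
    calc ∫ x in Set.Ioi (0 : ℝ), exp (-x) * x ^ (p + 1 - 1)
        ≤ ∫ x in Set.Ioi (0 : ℝ), ((p + 1) / exp 1) ^ p * exp (-(1 / (p + 1)) * x) := by
          refine setIntegral_mono_on (GammaIntegral_convergent hp1)
            ((integrableOn_exp_mul_Ioi hneg 0).const_mul _) measurableSet_Ioi fun x hx => ?_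
          rw [add_sub_cancel_right]
          refine (mul_le_mul_of_nonneg_left (hpt x hx) (exp_pos _).le).trans_eq ?_
          rw [mul_left_comm, ← exp_add]
          congr 2
          field_simp
          ring
      _ = _ := by
          rw [integral_const_mul, integral_exp_mul_Ioi hneg]
          simp
  calc (25 / 16 : ℝ) ^ p * Gamma (p + 1)
      ≤ (25 / 16 : ℝ) ^ p * (((p + 1) / exp 1) ^ p * (16 / 25 * exp 1) ^ p) := by
        gcongr
        exact hG.trans (by gcongr)
    _ = (p + 1) ^ p := by
        rw [← mul_rpow (by positivity) (by positivity), ← mul_rpow (by positivity) (by positivity)]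
        congr 1
        have := (exp_pos 1).ne'
        field_simp

lemma IsLogConcaveRV.integral_abs_rpow_le {μ : Measure Ω} [IsProbabilityMeasure μ]
    {X : Ω → ℝ} (hX : Measurable X) (h : IsLogConcaveRV μ X)
    (hint : Integrable (fun ω => X ω ^ 2) μ) (h1 : ∫ ω, X ω ^ 2 ∂μ ≤ 1) {p : ℝ} (hp : 2 ≤ p) :
    ∫ ω, |X ω| ^ p ∂μ ≤ (p + 1) ^ p := by
  have hp0 : 0 < p := by linarith
  have hC : 0 ≤ (25 / 16 : ℝ) ^ p * Gamma (p + 1) :=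
    mul_nonneg (by positivity) (Gamma_nonneg_of_nonneg (by linarith))
  have hXneg : Measurable fun ω => -X ω := hX.neg
  have hneg : IsLogConcaveRV μ (fun ω => -X ω) := by
    simpa using h.const_mul (c := -1) (by norm_num)
  have hp_pos := h.lintegral_rpow_max_zero_le hX hint h1 hp
  have hp_neg := hneg.lintegral_rpow_max_zero_le hXneg (by simpa using hint)
    (by simpa using h1) hp
  have hsplit : ∀ x : ℝ, ENNReal.ofReal (|x| ^ p) =
      ENNReal.ofReal (max x 0 ^ p) + ENNReal.ofReal (max (-x) 0 ^ p) := by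
    intro x
    rcases le_total x 0 with hx | hx
    · rw [max_eq_right hx, max_eq_left (by linarith), abs_of_nonpos hx, zero_rpow hp0.ne']
      simp
    · rw [max_eq_left hx, max_eq_right (by linarith), abs_of_nonneg hx, zero_rpow hp0.ne']
      simp
  have hprob : μ.real {ω | 0 < X ω} + μ.real {ω | 0 < -X ω} ≤ 1 := by
    rw [← measureReal_union _ (measurableSet_lt measurable_const hXneg)]
    · exact measureReal_le_one
    · rw [Set.disjoint_left]
      intro ω h1 h2
      simp only [Set.mem_ofPred_eq] at h1 h2
      linarith
  rw [integral_eq_lintegral_of_nonneg_ae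
    (Filter.Eventually.of_forall fun ω => rpow_nonneg (abs_nonneg _) _)
    (hX.abs.pow_const p).aestronglyMeasurable]
  refine ENNReal.toReal_le_of_le_ofReal (by positivity) ?_
  simp only [hsplit]
  rw [lintegral_add_left ((hX.max measurable_const).pow_const p).ennreal_ofReal]
  refine (add_le_add hp_pos hp_neg).trans ?_
  rw [← ENNReal.ofReal_add (mul_nonneg measureReal_nonneg hC) (mul_nonneg measureReal_nonneg hC),
    ← add_mul]
  exact ENNReal.ofReal_le_ofReal
    ((mul_le_of_le_one_left hC hprob).trans (Gamma_add_one_le_rpow hp))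

/-- If `Y` is log-concave (not necessarily centered), then for every `p ≥ 2`,
`(E|Y|^p)^(1/p) ≤ (p+1)·(E Y²)^(1/2)`. -/
theorem logconcave_moment_bound (μ : Measure Ω) [IsProbabilityMeasure μ]
    (Y : Ω → ℝ) (hmeas : Measurable Y) (hlc : IsLogConcaveRV μ Y)
    (p : ℝ) (hp : 2 ≤ p) :
    (∫ ω, |Y ω| ^ p ∂μ) ^ (1 / p) ≤ (p + 1) * Real.sqrt (∫ ω, (Y ω) ^ 2 ∂μ) := by
  have hp0 : 0 < p := by linarith
  have hzero : ∫ ω, |Y ω| ^ p ∂μ = 0 →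
      (∫ ω, |Y ω| ^ p ∂μ) ^ (1 / p) ≤ (p + 1) * Real.sqrt (∫ ω, (Y ω) ^ 2 ∂μ) := by
    intro h
    rw [h, zero_rpow (by positivity)]
    positivity
  by_cases hint : Integrable (fun ω => Y ω ^ 2) μ
  · have hnn : 0 ≤ ∫ ω, Y ω ^ 2 ∂μ := integral_nonneg fun ω => sq_nonneg _
    rcases hnn.eq_or_lt with h0 | h0
    · apply hzero
      have hae := (integral_eq_zero_iff_of_nonneg (fun ω => sq_nonneg (Y ω)) hint).1 h0.symm
      rw [integral_eq_zero_of_ae]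
      filter_upwards [hae] with ω hω
      have : Y ω = 0 := by simpa using hω
      simp [this, hp0.ne']
    · obtain ⟨σ, hσ⟩ : ∃ σ, σ = √(∫ ω, Y ω ^ 2 ∂μ) := ⟨_, rfl⟩
      have hσ0 : 0 < σ := hσ ▸ sqrt_pos.2 h0
      have hσ2 : ∫ ω, Y ω ^ 2 ∂μ = σ ^ 2 := by rw [hσ, sq_sqrt hnn]
      have hbound := (hlc.const_mul (inv_ne_zero hσ0.ne')).integral_abs_rpow_le
        (hmeas.const_mul σ⁻¹)
        (by simpa only [mul_pow] using hint.const_mul (σ⁻¹ ^ 2))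
        (by
          simp only [mul_pow]
          rw [integral_const_mul, hσ2, ← mul_pow, inv_mul_cancel₀ hσ0.ne', one_pow]) hp
      have hscale : ∀ ω, |σ⁻¹ * Y ω| ^ p = (σ ^ p)⁻¹ * |Y ω| ^ p := by
        intro ω
        rw [abs_mul, mul_rpow (abs_nonneg _) (abs_nonneg _), abs_of_pos (inv_pos.2 hσ0),
          inv_rpow hσ0.le]
      simp only [hscale] at hbound
      rw [integral_const_mul, inv_mul_le_iff₀ (by positivity), mul_comm,
        ← mul_rpow (by linarith) hσ0.le] at hbound
      rw [← hσ, one_div]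
      exact (rpow_inv_le_iff_of_pos (integral_nonneg fun ω => by positivity)
        (by positivity) hp0).2 hbound
  · apply hzero
    refine integral_undef fun hI => hint ?_
    refine ((integrable_const 1).add hI).mono' (hmeas.pow_const 2).aestronglyMeasurable
      (Filter.Eventually.of_forall fun ω => ?_)
    rw [norm_of_nonneg (sq_nonneg _), ← sq_abs]
    simp only [Pi.add_apply]
    rcases le_total |Y ω| 1 with h | h
    · have := rpow_nonneg (abs_nonneg (Y ω)) p
      nlinarith [abs_nonneg (Y ω)]
    · have := rpow_le_rpow_of_exponent_le h hp
      rw [rpow_two] at this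
      linarith

end
end
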